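/- arXiv:cs/0111062 — 7 statements merged into one kernel-verified Lean document; each statement's English description precedes it below -/
import Mathlib

section
/- Let f : {0,1}^n → {0,1}, let y_1,…,y_k be a partition of its variables into nonempty blocks, and let F be a strong probabilistic formula computing f with bounded error. For a formula drawn from F let L_i denote the number of its leaves labeled by variables in y_i. Then for every i ∈ {1,…,k} there exists a public-coin randomized one-way protocol computing the communication game f_i with error 1/3 whose average cost is at most 4·E[L_i] + 2. In particular, the sum over i = 1,…,k of the minimal average costs of public-coin randomized one-way protocols with error 1/3 for the games f_i is at most 4·size(F) + 2k. -/
open scoped ENNReal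

/-- A Boolean formula over variables `V`. -/
inductive BFormula (V : Type) : Type
  | var : V → BFormula V
  | const : Bool → BFormula V
  | node : (Bool → Bool → Bool) → BFormula V → BFormula V → BFormula V

namespace BFormula

/-- Evaluation of a formula on an assignment. -/
def eval {V : Type} (x : V → Bool) : BFormula V → Bool
  | var v => x v
  | const b => b
  | node g l r => g (eval x l) (eval x r)

/-- Number of leaves labeled by a variable satisfying `P`. -/
def sizeP {V : Type} (P : V → Bool) : BFormula V → ℕ
  | var v => if P v then 1 else 0
  | const _ => 0
  | node _ l r => sizeP P l + sizeP P r

/-- Number of leaves labeled by variables. -/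
def size {V : Type} (F : BFormula V) : ℕ := sizeP (fun _ => true) F

end BFormula

/-- Expected size of a strong probabilistic formula (distribution on formulas). -/
noncomputable def pmfSize {V : Type} (p : PMF (BFormula V)) : ℝ≥0∞ :=
  ∑' F, p F * (F.size : ℝ≥0∞)

/-- A strong probabilistic formula computes `f` with bounded error (2/3). -/
def ComputesBdd {V : Type} (p : PMF (BFormula V)) (f : (V → Bool) → Bool) : Prop :=
  ∀ x : V → Bool, 2/3 ≤ ∑' F, (if F.eval x = f x then p F else 0)

/-- Alice's inputs in the `i`-th communication game: variables outside block `i`. -/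
def AliceT {n k : ℕ} (y : Fin n → Fin k) (i : Fin k) : Type := {j : Fin n // y j ≠ i} → Bool
/-- Bob's inputs in the `i`-th communication game: variables in block `i`. -/
def BobT {n k : ℕ} (y : Fin n → Fin k) (i : Fin k) : Type := {j : Fin n // y j = i} → Bool

/-- Combining Alice's and Bob's inputs to a full input. -/
def combine {n k : ℕ} (y : Fin n → Fin k) (i : Fin k)
    (a : AliceT y i) (b : BobT y i) : Fin n → Bool :=
  fun j => if h : y j = i then b ⟨j, h⟩ else a ⟨j, h⟩

/-- The `i`-th communication game induced by `f` and the partition `y`. -/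
def game {n k : ℕ} (f : (Fin n → Bool) → Bool) (y : Fin n → Fin k) (i : Fin k) :
    AliceT y i → BobT y i → Bool :=
  fun a b => f (combine y i a b)

/-- Deterministic one-way communication complexity. -/
noncomputable def Dcc {A B : Type} (g : A → B → Bool) : ℕ :=
  sInf {c : ℕ | ∃ M : A → Fin (2^c), ∃ o : Fin (2^c) → B → Bool, ∀ a b, o (M a) b = g a b}

/-- `S` is shattered by the rows of `g`. -/
def Shatters {A B : Type} (g : A → B → Bool) (S : Finset B) : Prop :=
  ∀ R ⊆ S, ∃ a : A, ∀ b ∈ S, (g a b = true ↔ b ∈ R)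

/-- VC-dimension of the two-party problem `g`. -/
noncomputable def VCdim {A B : Type} (g : A → B → Bool) : ℕ :=
  sSup {d : ℕ | ∃ S : Finset B, Shatters g S ∧ S.card = d}
/-- A public-coin randomized one-way protocol: a distribution over pairs of a
message function (messages are bit strings) and an output function. -/
abbrev PubProt (A B : Type) := PMF ((A → List Bool) × (List Bool → B → Bool))

/-- The protocol computes `g` with error 1/3. -/
def PubComputes {A B : Type} (π : PubProt A B) (g : A → B → Bool) : Prop :=
  ∀ a b, 2/3 ≤ ∑' q, (if q.2 (q.1 a) b = g a b then π q else 0)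

/-- The average cost: maximum over Alice's inputs of the expected message length. -/
noncomputable def avgCost {A B : Type} (π : PubProt A B) : ℝ≥0∞ :=
  ⨆ a : A, ∑' q, π q * ((q.1 a).length : ℝ≥0∞)

/-- The minimal average cost of a public-coin randomized one-way protocol
computing `g` with error 1/3. -/
noncomputable def Rcost {A B : Type} (g : A → B → Bool) : ℝ≥0∞ :=
  ⨅ π : {π : PubProt A B // PubComputes π g}, avgCost π.val

/-- `g` has a deterministic one-way protocol in which all messages have length `c`. -/
def OneWayLength {A B : Type} (c : ℕ) (g : A → B → Bool) : Prop :=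
  ∃ (M : A → List Bool) (o : List Bool → B → Bool),
    (∀ a, (M a).length = c) ∧ ∀ a b, o (M a) b = g a b

namespace OneWayLength

theorem of_right {A B : Type} (g : B → Bool) : OneWayLength 0 (fun (_ : A) b => g b) :=
  ⟨fun _ => [], fun _ b => g b, fun _ => rfl, fun _ _ => rfl⟩

theorem comp_two {A B : Type} {c d : ℕ} {g₁ g₂ : A → B → Bool} (h : Bool → Bool → Bool)
    (h₁ : OneWayLength c g₁) (h₂ : OneWayLength d g₂) :
    OneWayLength (c + d) (fun a b => h (g₁ a b) (g₂ a b)) := by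
  obtain ⟨M₁, o₁, hl₁, ho₁⟩ := h₁
  obtain ⟨M₂, o₂, hl₂, ho₂⟩ := h₂
  refine ⟨fun a => M₁ a ++ M₂ a, fun m b => h (o₁ (m.take c) b) (o₂ (m.drop c) b), ?_, ?_⟩
  · intro a
    simp [hl₁, hl₂]
  · intro a b
    simp only [List.take_left' (hl₁ a), List.drop_left' (hl₁ a), ho₁, ho₂]

theorem comp_unary {A B : Type} {c : ℕ} {g : A → B → Bool} (u : A → Bool → Bool)
    (h : OneWayLength c g) : OneWayLength (c + 2) (fun a b => u a (g a b)) := by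
  obtain ⟨M, o, hl, ho⟩ := h
  refine ⟨fun a => M a ++ [u a false, u a true],
    fun m b => bif o (m.take c) b then (m.drop c).getD 1 false else (m.drop c).getD 0 false,
    ?_, ?_⟩
  · intro a
    simp [hl]
  · intro a b
    simp only [List.take_left' (hl a), List.drop_left' (hl a), ho]
    cases g a b <;> rfl

end OneWayLength

namespace BFormula

theorem eval_congr_of_sizeP_eq_zero {V : Type} {P : V → Bool} {x x' : V → Bool}
    (h : ∀ v, P v = false → x v = x' v) (F : BFormula V) (hF : F.sizeP P = 0) :
    F.eval x = F.eval x' := by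
  induction F with
  | var v =>
    apply h
    simpa [sizeP] using hF
  | const b => rfl
  | node g l r ihl ihr =>
    simp only [sizeP, Nat.add_eq_zero_iff] at hF
    simp only [eval, ihl hF.1, ihr hF.2]

theorem sum_sizeP_fiber {V ι : Type} [Fintype ι] [DecidableEq ι] (y : V → ι) (F : BFormula V) :
    ∑ i, F.sizeP (fun v => decide (y v = i)) = F.size := by
  unfold size
  induction F with
  | var v => simp [sizeP]
  | const b => simp [sizeP]
  | node g l r ihl ihr => simp only [sizeP, Finset.sum_add_distrib, ihl, ihr]

/-- Up to a unary function known to Alice, `4 L - 4` bits suffice to evaluate a formula with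
`L` leaves held by Bob. -/
theorem exists_oneWayLength_unary {V A B : Type} [Nonempty B] {P : V → Bool}
    {x : A → B → V → Bool}
    (hA : ∀ a b b' v, P v = false → x a b v = x a b' v)
    (hB : ∀ a a' b v, P v = true → x a b v = x a' b v) (F : BFormula V) :
    ∃ (g : A → B → Bool) (u : A → Bool → Bool),
      OneWayLength (4 * F.sizeP P - 4) g ∧ ∀ a b, F.eval (x a b) = u a (g a b) := by
  have const_of_zero : ∀ F : BFormula V, F.sizeP P = 0 →
      ∃ c : A → Bool, ∀ a b, F.eval (x a b) = c a := fun F hF =>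
    ⟨fun a => F.eval (x a (Classical.arbitrary B)),
      fun a b => eval_congr_of_sizeP_eq_zero (hA a b _) F hF⟩
  induction F with
  | var v =>
    by_cases hv : P v = true
    · rcases isEmpty_or_nonempty A with hE | ⟨⟨a₀⟩⟩
      · exact ⟨fun _ _ => false, fun _ t => t,
          by simpa [sizeP, hv] using OneWayLength.of_right _, fun a => hE.elim a⟩
      · exact ⟨fun _ b => x a₀ b v, fun _ t => t,
          by simpa [sizeP, hv] using OneWayLength.of_right _, fun a b => hB a a₀ b v hv⟩
    · obtain ⟨c, hc⟩ := const_of_zero (var v) (by simp [sizeP, hv])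
      exact ⟨fun _ _ => false, fun a _ => c a,
        by simpa [sizeP, hv] using OneWayLength.of_right _, hc⟩
  | const b =>
    exact ⟨fun _ _ => false, fun _ _ => b,
      by simpa [sizeP] using OneWayLength.of_right _, fun _ _ => rfl⟩
  | node h l r ihl ihr =>
    obtain ⟨gl, ul, hl, el⟩ := ihl
    obtain ⟨gr, ur, hr, er⟩ := ihr
    by_cases zl : l.sizeP P = 0
    · obtain ⟨c, hc⟩ := const_of_zero l zl
      exact ⟨gr, fun a t => h (c a) (ur a t), by simpa [sizeP, zl] using hr,
        fun a b => by simp only [eval, hc, er]⟩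
    by_cases zr : r.sizeP P = 0
    · obtain ⟨c, hc⟩ := const_of_zero r zr
      exact ⟨gl, fun a t => h (ul a t) (c a), by simpa [sizeP, zr] using hl,
        fun a b => by simp only [eval, hc, el]⟩
    refine ⟨fun a b => h (ul a (gl a b)) (ur a (gr a b)), fun _ t => t, ?_, fun a b => ?_⟩
    · have e : 4 * (node h l r).sizeP P - 4
          = (4 * l.sizeP P - 4 + 2) + (4 * r.sizeP P - 4 + 2) := by
        simp only [sizeP]
        omega
      rw [e]
      exact (hl.comp_unary ul).comp_two h (hr.comp_unary ur)
    · simp only [eval, el, er]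

theorem exists_oneWay_protocol {V A B : Type} [Nonempty B] {P : V → Bool}
    {x : A → B → V → Bool}
    (hA : ∀ a b b' v, P v = false → x a b v = x a b' v)
    (hB : ∀ a a' b v, P v = true → x a b v = x a' b v) (F : BFormula V) :
    ∃ q : (A → List Bool) × (List Bool → B → Bool),
      (∀ a, (q.1 a).length ≤ 4 * F.sizeP P + 2) ∧
        ∀ a b, q.2 (q.1 a) b = F.eval (x a b) := by
  obtain ⟨g, u, hg, hu⟩ := exists_oneWayLength_unary hA hB F
  obtain ⟨M, o, hl, ho⟩ := hg.comp_unary u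
  refine ⟨(M, o), fun a => ?_, fun a b => (ho a b).trans (hu a b).symm⟩
  have := hl a
  dsimp only
  omega

end BFormula

theorem PMF.tsum_map_mul {α β : Type*} (p : PMF α) (φ : α → β) (h : β → ℝ≥0∞) :
    ∑' b, p.map φ b * h b = ∑' a, p a * h (φ a) := by
  classical
  simp only [PMF.map_apply, ← ENNReal.tsum_mul_right]
  rw [ENNReal.tsum_comm]
  refine tsum_congr fun a => ?_
  rw [tsum_eq_single (φ a) (fun b hb => by simp [hb])]
  simp

theorem exists_pubProt {n k : ℕ} (f : (Fin n → Bool) → Bool) (y : Fin n → Fin k)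
    (p : PMF (BFormula (Fin n))) (hp : ComputesBdd p f) (i : Fin k) :
    ∃ π : PubProt (AliceT y i) (BobT y i), PubComputes π (game f y i) ∧
      avgCost π ≤
        4 * (∑' F, p F * (F.sizeP (fun j => decide (y j = i)) : ℝ≥0∞)) + 2 := by
  have : Nonempty (BobT y i) := ⟨fun _ => false⟩
  choose q hlen hq using BFormula.exists_oneWay_protocol (A := AliceT y i) (B := BobT y i)
    (P := fun j => decide (y j = i)) (x := combine y i)
    (fun a b b' v hv => by
      have hv' : ¬ y v = i := by simpa using hv
      simp [combine, hv'])
    (fun a a' b v hv => by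
      have hv' : y v = i := by simpa using hv
      simp [combine, hv'])
  refine ⟨p.map q, fun a b => ?_, iSup_le fun a => ?_⟩
  · calc (2 / 3 : ℝ≥0∞)
        ≤ ∑' F, (if F.eval (combine y i a b) = f (combine y i a b) then p F else 0) := hp _
      _ = ∑' F, p F * (if (q F).2 ((q F).1 a) b = game f y i a b then 1 else 0) := by
          simp only [hq, game, mul_ite, mul_one, mul_zero]
      _ = ∑' r, p.map q r * (if r.2 (r.1 a) b = game f y i a b then 1 else 0) :=
          (p.tsum_map_mul q fun r => if r.2 (r.1 a) b = game f y i a b then 1 else 0).symm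
      _ = _ := by simp only [mul_ite, mul_one, mul_zero]
  · rw [p.tsum_map_mul q fun r => ((r.1 a).length : ℝ≥0∞)]
    calc ∑' F, p F * (((q F).1 a).length : ℝ≥0∞)
        ≤ ∑' F, (4 * (p F * (F.sizeP (fun j => decide (y j = i)) : ℝ≥0∞)) + p F * 2) := by
          refine ENNReal.tsum_le_tsum fun F => ?_
          calc p F * (((q F).1 a).length : ℝ≥0∞)
              ≤ p F * (4 * (F.sizeP (fun j => decide (y j = i)) : ℝ≥0∞) + 2) := by
                gcongr
                exact_mod_cast hlen F a
            _ = _ := by ring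
      _ = _ := by
          rw [ENNReal.tsum_add, ENNReal.tsum_mul_left, ENNReal.tsum_mul_right, p.tsum_coe,
            one_mul]

/-- Simulating a strong probabilistic bounded-error formula for `f` in the `i`-th
communication game of a partition `y` gives, for each `i`, a public-coin randomized
one-way protocol with error 1/3 of average cost at most `4·E[L_i] + 2`, where `L_i`
is the number of leaves of the drawn formula labeled by variables of block `i`.
In particular the sum of the minimal average costs is at most `4·size + 2k`. -/
theorem stmt0 {n k : ℕ} (f : (Fin n → Bool) → Bool) (y : Fin n → Fin k)
    (hy : Function.Surjective y)
    (p : PMF (BFormula (Fin n))) (hp : ComputesBdd p f) :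
    (∀ i : Fin k, ∃ π : PubProt (AliceT y i) (BobT y i),
        PubComputes π (game f y i) ∧
        avgCost π ≤ 4 * (∑' F, p F * (F.sizeP (fun j => decide (y j = i)) : ℝ≥0∞)) + 2) ∧
    (∑ i : Fin k, Rcost (game f y i)) ≤ 4 * pmfSize p + 2 * k := by
  refine ⟨exists_pubProt f y p hp, ?_⟩
  calc ∑ i, Rcost (game f y i)
      ≤ ∑ i, (4 * (∑' F, p F * (F.sizeP (fun j => decide (y j = i)) : ℝ≥0∞)) + 2) := by
        refine Finset.sum_le_sum fun i _ => ?_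
        obtain ⟨π, hπ, hc⟩ := exists_pubProt f y p hp i
        exact (iInf_le _ (⟨π, hπ⟩ : {π // PubComputes π (game f y i)})).trans hc
    _ = 4 * pmfSize p + 2 * k := by
        rw [Finset.sum_add_distrib, ← Finset.mul_sum,
          ← Summable.tsum_finsetSum fun _ _ => ENNReal.summable]
        simp only [← Finset.mul_sum, ← Nat.cast_sum, BFormula.sum_sizeP_fiber, pmfSize]
        simp [mul_comm]
end

section
/- There is a universal constant c > 0 with the following property. Let f : {0,1}^n → {0,1} and let y_1,…,y_k be a partition of its variables into nonempty blocks. (a) Every strong probabilistic formula computing f with bounded error has size at least c·(∑_{i=1}^k VC(f_i)) − k. (b) Every strong Las Vegas formula computing f has size at least c·(∑_{i=1}^k D(f_i)) − k. -/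
open scoped ENNReal

/-- Expected size of a strong Las Vegas formula: a distribution on pairs
(output formula, verifying formula). -/
noncomputable def lvSize {V : Type} (p : PMF (BFormula V × BFormula V)) : ℝ≥0∞ :=
  ∑' q, p q * ((q.1.size + q.2.size : ℕ) : ℝ≥0∞)

/-- A strong Las Vegas formula computes `f`: the result (the value of the output
formula when the verifying formula accepts, and `?` otherwise) is never the wrong
Boolean value, and the result `?` appears with probability at most 1/2. -/
def ComputesLV {n : ℕ} (p : PMF (BFormula (Fin n) × BFormula (Fin n)))
    (f : (Fin n → Bool) → Bool) : Prop :=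
  ∀ x : Fin n → Bool,
    (∑' q, (if q.2.eval x = true ∧ q.1.eval x ≠ f x then p q else 0)) = 0 ∧
    (∑' q, (if q.2.eval x = false then p q else 0)) ≤ 1/2

/-- The function `h` has a deterministic one-way protocol of cost `c`. -/
def HasOneWay {A B : Type} (h : A → B → Bool) (c : ℕ) : Prop :=
  ∃ M : A → Fin (2 ^ c), ∃ o : Fin (2 ^ c) → B → Bool, ∀ a b, o (M a) b = h a b

/-- A one-way protocol with an arbitrary finite message type can be encoded in bits. -/
theorem HasOneWay.of_fintype {A B Msg : Type} [Fintype Msg] {h : A → B → Bool} {c : ℕ}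
    (hc : Fintype.card Msg ≤ 2 ^ c) (M : A → Msg) (o : Msg → B → Bool)
    (ho : ∀ a b, o (M a) b = h a b) : HasOneWay h c := by
  classical
  have hcard : Fintype.card Msg ≤ Fintype.card (Fin (2 ^ c)) := by simpa using hc
  obtain ⟨e⟩ := Function.Embedding.nonempty_of_card_le hcard
  refine ⟨fun a => e (M a), fun μ b => if hμ : ∃ ν, e ν = μ then o hμ.choose b else false, ?_⟩
  intro a b
  have hex : ∃ ν, e ν = e (M a) := ⟨M a, rfl⟩
  simp only [dif_pos hex]
  rw [e.injective hex.choose_spec, ho]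

namespace BFormula

/-- After fixing the variables outside `P`, a formula is, up to an outer unary function, one of at
most `16 ^ (L - 1)` functions, where `L` is the number of leaves labeled by variables in `P`. -/
theorem exists_message {V A B : Type} (P : V → Bool) (x : A → B → V → Bool)
    (hA : ∀ v, P v = false → ∀ a b b', x a b v = x a b' v)
    (hB : ∀ v, P v = true → ∀ a a' b, x a b v = x a' b v) (F : BFormula V) :
    (F.sizeP P = 0 → ∀ a b b', F.eval (x a b) = F.eval (x a b')) ∧
    ∃ (Msg : Type) (_ : Fintype Msg), Fintype.card Msg ≤ 16 ^ (F.sizeP P - 1) ∧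
      ∃ (M : A → Msg) (o : Msg → B → Bool) (u : A → Bool → Bool),
        ∀ a b, F.eval (x a b) = u a (o (M a) b) := by
  classical
  have hzero : ∀ G : BFormula V, (∀ a b b', G.eval (x a b) = G.eval (x a b')) →
      ∃ v : A → Bool, ∀ a b, G.eval (x a b) = v a := by
    intro G hG
    by_cases hb : Nonempty B
    · exact ⟨fun a => G.eval (x a hb.some), fun a b => hG a b _⟩
    · exact ⟨fun _ => false, fun a b => (hb ⟨b⟩).elim⟩
  have hconst : ∀ G : BFormula V, (∀ a b b', G.eval (x a b) = G.eval (x a b')) → ∀ k,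
      ∃ (Msg : Type) (_ : Fintype Msg), Fintype.card Msg ≤ 16 ^ k ∧
      ∃ (M : A → Msg) (o : Msg → B → Bool) (u : A → Bool → Bool),
        ∀ a b, G.eval (x a b) = u a (o (M a) b) := by
    intro G hG k
    obtain ⟨v, hv⟩ := hzero G hG
    exact ⟨Unit, inferInstance, by simpa using Nat.one_le_pow k 16 (by norm_num), fun _ => (),
      fun _ _ => false, fun a _ => v a, hv⟩
  induction F with
  | const c => exact ⟨fun _ _ _ _ => rfl, hconst _ (fun _ _ _ => rfl) _⟩
  | var v =>
    rcases hv : P v with _ | _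
    · exact ⟨fun _ => hA v hv, hconst (var v) (hA v hv) _⟩
    · refine ⟨fun h => by simp [sizeP, hv] at h, ?_⟩
      by_cases ha : Nonempty A
      · exact ⟨Unit, inferInstance, by simp [sizeP, hv], fun _ => (),
          fun _ b => x ha.some b v, fun _ => id, fun a b => hB v hv a _ b⟩
      · exact ⟨Unit, inferInstance, by simp [sizeP, hv], fun _ => (), fun _ _ => false,
          fun _ => id, fun a => (ha ⟨a⟩).elim⟩
  | node g l r ihl ihr =>
    obtain ⟨hl0, Ml, _, hcl, ml, ol, ul, hl⟩ := ihl
    obtain ⟨hr0, Mr, _, hcr, mr, or, ur, hr⟩ := ihr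
    refine ⟨fun h a b b' => ?_, ?_⟩
    · simp only [sizeP, Nat.add_eq_zero_iff] at h
      simp only [eval, hl0 h.1 a b b', hr0 h.2 a b b']
    · by_cases hL : l.sizeP P = 0
      · obtain ⟨v, hv⟩ := hzero l (hl0 hL)
        exact ⟨Mr, inferInstance, by simpa [sizeP, hL] using hcr, mr, or,
          fun a t => g (v a) (ur a t), fun a b => by simp only [eval, hv, hr]⟩
      by_cases hR : r.sizeP P = 0
      · obtain ⟨v, hv⟩ := hzero r (hr0 hR)
        exact ⟨Ml, inferInstance, by simpa [sizeP, hR] using hcl, ml, ol,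
          fun a t => g (ul a t) (v a), fun a b => by simp only [eval, hv, hl]⟩
      refine ⟨(Ml × (Bool → Bool)) × (Mr × (Bool → Bool)), inferInstance, ?_,
        fun a => ((ml a, ul a), (mr a, ur a)),
        fun μ b => g (μ.1.2 (ol μ.1.1 b)) (μ.2.2 (or μ.2.1 b)), fun _ => id,
        fun a b => by simp only [eval, hl, hr, id]⟩
      have hexp : l.sizeP P + r.sizeP P - 1 = (l.sizeP P - 1) + (r.sizeP P - 1) + 1 := by omega
      simp only [sizeP, hexp, Fintype.card_prod, Fintype.card_fun, Fintype.card_bool, pow_succ,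
        pow_add]
      nlinarith [Nat.mul_le_mul hcl hcr]

/-- A formula with `L` leaves in Bob's block yields a one-way protocol of cost `4 L + 2`. -/
theorem hasOneWay {V A B : Type} (P : V → Bool) (x : A → B → V → Bool)
    (hA : ∀ v, P v = false → ∀ a b b', x a b v = x a b' v)
    (hB : ∀ v, P v = true → ∀ a a' b, x a b v = x a' b v) (F : BFormula V) :
    HasOneWay (fun a b => F.eval (x a b)) (4 * F.sizeP P + 2) := by
  classical
  obtain ⟨-, Msg, _, hc, M, o, u, h⟩ := exists_message P x hA hB F
  refine HasOneWay.of_fintype (Msg := Msg × (Bool → Bool)) ?_ (fun a => (M a, u a))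
    (fun μ b => μ.2 (o μ.1 b)) (fun a b => (h a b).symm)
  have h16 : (16 : ℕ) ^ (F.sizeP P - 1) ≤ 16 ^ F.sizeP P :=
    Nat.pow_le_pow_right (by norm_num) (Nat.sub_le _ _)
  simp only [Fintype.card_prod, Fintype.card_fun, Fintype.card_bool, pow_add, pow_mul]
  norm_num
  omega

/-- Every variable leaf lies in exactly one block. -/
theorem sum_sizeP {V : Type} {k : ℕ} (y : V → Fin k) (F : BFormula V) :
    ∑ i, F.sizeP (fun v => decide (y v = i)) = F.size := by
  induction F with
  | var v => simp [size, sizeP]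
  | const c => simp [size, sizeP]
  | node g l r ihl ihr => simp only [size, sizeP, Finset.sum_add_distrib] at *; omega

end BFormula

/-- Averaging a bound on the weight of the correctly handled inputs over a distribution. -/
theorem PMF.ofReal_mul_sum_le {Ω ι : Type} (p : PMF Ω) (s : Finset ι) (w : ι → ℝ)
    (hw : ∀ i ∈ s, 0 ≤ w i) (G : ι → Ω → Prop) [∀ i ω, Decidable (G i ω)] {τ α β : ℝ}
    (hτ0 : 0 ≤ τ) (hα : 0 ≤ α) (hβ : 0 ≤ β) (m : Ω → ℕ)
    (hτ : ∀ i ∈ s, ENNReal.ofReal τ ≤ ∑' ω, if G i ω then p ω else 0)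
    (hu : ∀ ω, p ω ≠ 0 → ∑ i ∈ s, (if G i ω then w i else 0) ≤ α * m ω + β) :
    ENNReal.ofReal (τ * ∑ i ∈ s, w i) ≤
      ENNReal.ofReal α * (∑' ω, p ω * (m ω : ℝ≥0∞)) + ENNReal.ofReal β := by
  calc ENNReal.ofReal (τ * ∑ i ∈ s, w i)
      = ∑ i ∈ s, ENNReal.ofReal τ * ENNReal.ofReal (w i) := by
        rw [ENNReal.ofReal_mul hτ0, ENNReal.ofReal_sum_of_nonneg hw, Finset.mul_sum]
    _ ≤ ∑ i ∈ s, (∑' ω, if G i ω then p ω else 0) * ENNReal.ofReal (w i) :=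
        Finset.sum_le_sum fun i hi => mul_le_mul_left (hτ i hi) _
    _ = ∑' ω, ∑ i ∈ s, (if G i ω then p ω else 0) * ENNReal.ofReal (w i) := by
        rw [Summable.tsum_finsetSum fun _ _ => ENNReal.summable]
        simp only [ENNReal.tsum_mul_right]
    _ ≤ ∑' ω, p ω * ENNReal.ofReal (α * m ω + β) := by
        refine ENNReal.tsum_le_tsum fun ω => ?_
        by_cases hp : p ω = 0
        · simp [hp]
        · refine le_trans (le_of_eq ?_) (mul_le_mul_right (ENNReal.ofReal_le_ofReal (hu ω hp)) _)
          rw [ENNReal.ofReal_sum_of_nonneg, Finset.mul_sum]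
          · exact Finset.sum_congr rfl fun i _ => by split_ifs <;> simp
          · intro i hi; split_ifs
            exacts [hw i hi, le_rfl]
    _ = ENNReal.ofReal α * (∑' ω, p ω * (m ω : ℝ≥0∞)) + ENNReal.ofReal β := by
        have hterm : ∀ ω, p ω * ENNReal.ofReal (α * m ω + β) =
            ENNReal.ofReal α * (p ω * (m ω : ℝ≥0∞)) + p ω * ENNReal.ofReal β := by
          intro ω
          rw [ENNReal.ofReal_add (by positivity) hβ, ENNReal.ofReal_mul hα, ENNReal.ofReal_natCast]
          ring
        simp only [hterm]
        rw [ENNReal.tsum_add, ENNReal.tsum_mul_left, ENNReal.tsum_mul_right, p.tsum_coe, one_mul]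

/-- Jensen's inequality for the exponential function and uniform weights. -/
theorem sum_le_of_sum_exp_le {ι : Type} (s : Finset ι) (X : ι → ℝ) (K : ℝ)
    (h : ∑ i ∈ s, Real.exp (X i) ≤ s.card * Real.exp K) : ∑ i ∈ s, X i ≤ s.card * K := by
  have hpt : ∀ i ∈ s, X i ≤ (K - 1) + Real.exp (X i) * Real.exp (-K) := by
    intro i _
    have := Real.add_one_le_exp (X i - K)
    rw [sub_eq_add_neg, Real.exp_add] at this
    linarith
  have hsum := Finset.sum_le_sum hpt
  rw [Finset.sum_add_distrib, ← Finset.sum_mul, Finset.sum_const, nsmul_eq_mul] at hsum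
  have hmul := mul_le_mul_of_nonneg_right h (Real.exp_pos (-K)).le
  rw [mul_assoc, ← Real.exp_add, add_neg_cancel, Real.exp_zero] at hmul
  linarith

/-- Summing over all subsets the weight `2 ^ agreement` with a fixed subset. -/
theorem sum_powerset_two_pow_agree {B : Type} [DecidableEq B] (S : Finset B) (t : B → Bool) :
    ∑ R ∈ S.powerset, (2 : ℝ) ^ (S.filter fun b => t b = decide (b ∈ R)).card = 3 ^ S.card := by
  have h := Finset.prod_add (fun b => if t b then (2 : ℝ) else 1)
    (fun b => if t b then (1 : ℝ) else 2) S
  have h3 : ∏ b ∈ S, ((if t b then (2 : ℝ) else 1) + if t b then (1 : ℝ) else 2) = 3 ^ S.card := by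
    rw [← Finset.prod_const]
    refine Finset.prod_congr rfl fun b _ => ?_
    split_ifs <;> norm_num
  rw [← h3, h]
  refine Finset.sum_congr rfl fun R hR => ?_
  rw [Finset.mem_powerset] at hR
  rw [← Finset.prod_const, Finset.prod_filter, ← Finset.prod_sdiff hR, mul_comm]
  congr 1
  · refine Finset.prod_congr rfl fun b hb => ?_
    simp [hb]
  · refine Finset.prod_congr rfl fun b hb => ?_
    have := (Finset.mem_sdiff.mp hb).2
    cases t b <;> simp [this]

theorem log_three_halves_le : Real.log (3 / 2) ≤ 3 / 5 * Real.log 2 := by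
  have h : Real.log ((3 / 2) ^ 5) ≤ Real.log (2 ^ 3) :=
    Real.log_le_log (by norm_num) (by norm_num)
  rw [Real.log_pow, Real.log_pow] at h
  push_cast at h
  linarith

/-- A short message cannot agree well with most subsets of a shattered set. -/
theorem sum_agree_le {A B : Type} [DecidableEq B] {h : A → B → Bool} {m : ℕ} (hm : HasOneWay h m)
    (S : Finset B) (a : Finset B → A) :
    ∑ R ∈ S.powerset, ((S.filter fun b => h (a R) b = decide (b ∈ R)).card : ℝ) ≤
      2 ^ S.card * (m + 3 / 5 * S.card) := by
  obtain ⟨M, o, ho⟩ := hm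
  have hlog2 : 0 < Real.log 2 := Real.log_pos (by norm_num)
  have hexp : ∑ R ∈ S.powerset,
      Real.exp ((S.filter fun b => h (a R) b = decide (b ∈ R)).card * Real.log 2) ≤
      S.powerset.card * Real.exp (m * Real.log 2 + S.card * Real.log (3 / 2)) := by
    have e1 : ∀ (x : ℝ) (_ : 0 < x) (j : ℕ), Real.exp (j * Real.log x) = x ^ j := by
      intro x hx j
      rw [Real.exp_nat_mul, Real.exp_log hx]
    rw [Real.exp_add]
    simp only [e1 2 (by norm_num), e1 (3 / 2) (by norm_num)]
    calc ∑ R ∈ S.powerset, (2 : ℝ) ^ (S.filter fun b => h (a R) b = decide (b ∈ R)).card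
        ≤ ∑ R ∈ S.powerset, ∑ μ : Fin (2 ^ m),
            (2 : ℝ) ^ (S.filter fun b => o μ b = decide (b ∈ R)).card := by
          refine Finset.sum_le_sum fun R _ => ?_
          simp only [← ho]
          exact Finset.single_le_sum (f := fun μ =>
            (2 : ℝ) ^ (S.filter fun b => o μ b = decide (b ∈ R)).card)
            (fun _ _ => by positivity) (Finset.mem_univ (M (a R)))
      _ = 2 ^ m * 3 ^ S.card := by
          rw [Finset.sum_comm]
          simp [sum_powerset_two_pow_agree]
      _ = _ := by
          rw [Finset.card_powerset]
          push_cast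
          rw [mul_left_comm, ← mul_pow]
          norm_num
  have hJ := sum_le_of_sum_exp_le _ _ _ hexp
  rw [← Finset.sum_mul, Finset.card_powerset] at hJ
  push_cast at hJ
  have hb : (m : ℝ) * Real.log 2 + S.card * Real.log (3 / 2) ≤
      (m + 3 / 5 * S.card) * Real.log 2 := by
    have := mul_le_mul_of_nonneg_left log_three_halves_le (Nat.cast_nonneg (α := ℝ) S.card)
    linarith
  have := hJ.trans (mul_le_mul_of_nonneg_left hb (by positivity))
  rw [← mul_assoc] at this
  exact le_of_mul_le_mul_right this hlog2

/-- A bounded-error distribution on one-way protocols has expected cost linear in the size of any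
shattered set. -/
theorem Shatters.card_le {A B Ω : Type} {g : A → B → Bool} {S : Finset B} (hS : Shatters g S)
    (p : PMF Ω) (ev : Ω → A → B → Bool) (m : Ω → ℕ) (hm : ∀ ω, HasOneWay (ev ω) (m ω))
    (hp : ∀ a b, 2 / 3 ≤ ∑' ω, if ev ω a b = g a b then p ω else 0) :
    (S.card : ℝ≥0∞) ≤ 15 * ∑' ω, p ω * (m ω : ℝ≥0∞) := by
  classical
  by_cases htop : (∑' ω, p ω * (m ω : ℝ≥0∞)) = ⊤
  · rw [htop, ENNReal.mul_top (by norm_num)]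
    exact le_top
  have hS' : ∀ R : Finset B, ∃ a : A, R ⊆ S → ∀ b ∈ S, (g a b = true ↔ b ∈ R) := by
    intro R
    by_cases hR : R ⊆ S
    · obtain ⟨a, ha⟩ := hS R hR
      exact ⟨a, fun _ => ha⟩
    · obtain ⟨a, -⟩ := hS ∅ (Finset.empty_subset S)
      exact ⟨a, fun h => (hR h).elim⟩
  choose a ha using hS'
  have key := p.ofReal_mul_sum_le (S.powerset ×ˢ S) (fun _ => 1) (fun _ _ => zero_le_one)
    (fun i ω => ev ω (a i.1) i.2 = g (a i.1) i.2) (τ := 2 / 3) (α := 2 ^ S.card)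
    (β := 2 ^ S.card * (3 / 5 * S.card)) (by norm_num) (by positivity) (by positivity) m
    (fun i _ => by
      refine le_trans (le_of_eq ?_) (hp _ _)
      rw [ENNReal.ofReal_div_of_pos (by norm_num)]
      norm_num)
    (fun ω _ => by
      rw [← mul_add]
      refine le_trans (le_of_eq ?_) (sum_agree_le (hm ω) S a)
      rw [Finset.sum_product]
      refine Finset.sum_congr rfl fun R hR => ?_
      rw [Finset.sum_boole]
      congr 2
      refine Finset.filter_congr fun b hb => ?_
      have hgb : g (a R) b = decide (b ∈ R) := by
        rw [Bool.eq_iff_iff, decide_eq_true_iff]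
        exact ha R (Finset.mem_powerset.mp hR) b hb
      simp only [hgb])
  set e := ∑' ω, p ω * (m ω : ℝ≥0∞) with he
  rw [← ENNReal.ofReal_toReal htop] at key ⊢
  rw [← ENNReal.ofReal_mul (by positivity), ← ENNReal.ofReal_add (by positivity) (by positivity),
    ENNReal.ofReal_le_ofReal_iff (by positivity)] at key
  simp only [Finset.sum_const, Finset.card_product, Finset.card_powerset, nsmul_eq_mul, mul_one]
    at key
  push_cast at key
  have hpos : (0 : ℝ) < 2 ^ S.card := by positivity
  have hfin : (S.card : ℝ) ≤ 15 * e.toReal := by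
    have h2 : (2 : ℝ) ^ S.card * (2 / 3 * S.card) ≤
        2 ^ S.card * (e.toReal + 3 / 5 * S.card) := by linarith
    have := le_of_mul_le_mul_left h2 hpos
    linarith
  calc (S.card : ℝ≥0∞) = ENNReal.ofReal S.card := (ENNReal.ofReal_natCast _).symm
    _ ≤ ENNReal.ofReal (15 * e.toReal) := ENNReal.ofReal_le_ofReal hfin
    _ = _ := by rw [ENNReal.ofReal_mul (by norm_num)]; norm_num

/-- Weights on the entries of a set of distinct rows which add up to the entropy of the uniform
distribution in every row, such that rows agreeing on many columns are few. -/
theorem exists_row_weights {B : Type} [Fintype B] [DecidableEq B] (T : Finset (B → Bool)) :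
    ∃ w : (B → Bool) → B → ℝ, (∀ r ∈ T, ∀ b, 0 ≤ w r b) ∧
      (∀ r ∈ T, ∑ b, w r b = Real.log T.card) ∧
      ∀ (Q : Finset B) (C : Finset (B → Bool)), C ⊆ T →
        (∀ r ∈ C, ∀ r' ∈ C, ∀ b ∈ Q, r b = r' b) →
        ∑ r ∈ C, Real.exp (∑ b ∈ Q, w r b) ≤ T.card := by
  induction hn : T.card using Nat.strong_induction_on generalizing T with
  | _ n ih =>
  subst hn
  by_cases hT : T.card ≤ 1
  · refine ⟨fun _ _ => 0, fun _ _ _ => le_rfl, fun r hr => ?_, fun Q C hC _ => ?_⟩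
    · have : T.card = 1 := le_antisymm hT (Finset.card_pos.mpr ⟨r, hr⟩)
      simp [this]
    · simpa using Finset.card_le_card hC
  obtain ⟨r₀, hr₀, r₁, hr₁, hne⟩ := Finset.one_lt_card.mp (not_le.mp hT)
  obtain ⟨c, hc⟩ := Function.ne_iff.mp hne
  let U : Bool → Finset (B → Bool) := fun β => T.filter fun r => r c = β
  have hUne : ∀ β, (U β).Nonempty := by
    intro β
    by_cases h0 : r₀ c = β
    · exact ⟨r₀, Finset.mem_filter.mpr ⟨hr₀, h0⟩⟩
    · refine ⟨r₁, Finset.mem_filter.mpr ⟨hr₁, ?_⟩⟩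
      revert h0 hc
      cases r₀ c <;> cases r₁ c <;> cases β <;> simp
  have hUadd : (U true).card + (U false).card = T.card := by
    have := Finset.card_filter_add_card_filter_not (s := T) (fun r => r c = true)
    simpa [U] using this
  have hUpos : ∀ β, 0 < (U β).card := fun β => (hUne β).card_pos
  have hUlt : ∀ β, (U β).card < T.card := by
    have h1 := hUpos true
    have h2 := hUpos false
    intro β
    cases β <;> omega
  choose w hw0 hw1 hw2 using fun β => ih _ (hUlt β) (U β) rfl
  have hTpos : (0 : ℝ) < T.card := by
    exact_mod_cast lt_trans (hUpos true) (hUlt true)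
  have hUposR : ∀ β, (0 : ℝ) < (U β).card := fun β => by exact_mod_cast hUpos β
  let v : (B → Bool) → B → ℝ := fun r b =>
    (if c = b then Real.log (T.card / (U (r c)).card) else 0) + w (r c) r b
  have hvsum : ∀ (Q : Finset B) r, ∑ b ∈ Q, v r b =
      (if c ∈ Q then Real.log (T.card / (U (r c)).card) else 0) + ∑ b ∈ Q, w (r c) r b := by
    intro Q r
    simp only [v, Finset.sum_add_distrib, Finset.sum_ite_eq]
  have hmem : ∀ r ∈ T, r ∈ U (r c) := fun r hr => Finset.mem_filter.mpr ⟨hr, rfl⟩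
  refine ⟨v, fun r hr b => ?_, fun r hr => ?_, fun Q C hC hagree => ?_⟩
  · refine add_nonneg ?_ (hw0 _ r (hmem r hr) b)
    split_ifs
    · refine Real.log_nonneg ((one_le_div (hUposR _)).mpr ?_)
      exact_mod_cast (hUlt _).le
    · exact le_rfl
  · rw [hvsum, if_pos (Finset.mem_univ c), hw1 _ r (hmem r hr),
      Real.log_div hTpos.ne' (hUposR _).ne']
    ring
  · have hbranch : ∀ β, ∑ r ∈ C.filter (fun r => r c = β), Real.exp (∑ b ∈ Q, w β r b) ≤
        (U β).card := fun β => hw2 β Q _ (Finset.filter_subset_filter _ hC)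
      fun r hr r' hr' => hagree r (Finset.mem_filter.mp hr).1 r' (Finset.mem_filter.mp hr').1
    by_cases hcQ : c ∈ Q
    · rcases C.eq_empty_or_nonempty with rfl | ⟨s, hs⟩
      · simp
      have hCs : C.filter (fun r => r c = s c) = C :=
        Finset.filter_true_of_mem fun r hr => hagree r hr s hs c hcQ
      have hb := hbranch (s c)
      rw [hCs] at hb
      calc ∑ r ∈ C, Real.exp (∑ b ∈ Q, v r b)
          = ∑ r ∈ C, T.card / (U (s c)).card * Real.exp (∑ b ∈ Q, w (s c) r b) := by
            refine Finset.sum_congr rfl fun r hr => ?_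
            rw [hvsum, if_pos hcQ, hagree r hr s hs c hcQ, Real.exp_add,
              Real.exp_log (div_pos hTpos (hUposR _))]
        _ ≤ T.card / (U (s c)).card * (U (s c)).card := by
            rw [← Finset.mul_sum]
            exact mul_le_mul_of_nonneg_left hb (div_pos hTpos (hUposR _)).le
        _ = T.card := div_mul_cancel₀ _ (hUposR _).ne'
    · have hsplit : ∑ r ∈ C, Real.exp (∑ b ∈ Q, v r b) =
          ∑ β : Bool, ∑ r ∈ C.filter (fun r => r c = β), Real.exp (∑ b ∈ Q, w β r b) := by
        rw [← Finset.sum_fiberwise C (fun r => r c)]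
        refine Finset.sum_congr rfl fun β _ => Finset.sum_congr rfl fun r hr => ?_
        rw [hvsum, if_neg hcQ, zero_add, (Finset.mem_filter.mp hr).2]
      rw [hsplit, Fintype.sum_bool, ← hUadd]
      push_cast
      exact add_le_add (hbranch true) (hbranch false)

/-- The rows of `g` can be used as messages. -/
theorem Dcc_le_clog {A B : Type} [Fintype A] [DecidableEq (B → Bool)] (g : A → B → Bool) :
    Dcc g ≤ Nat.clog 2 (Finset.univ.image g).card := by
  refine Nat.sInf_le (HasOneWay.of_fintype (Msg := (Finset.univ.image g : Finset (B → Bool)))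
    (by simpa using Nat.le_pow_clog (by norm_num) _)
    (fun a => ⟨g a, Finset.mem_image_of_mem g (Finset.mem_univ a)⟩) (fun μ b => μ.1 b)
    (fun _ _ => rfl))

theorem clog_mul_log_two_le (N : ℕ) :
    (Nat.clog 2 N : ℝ) * Real.log 2 ≤ Real.log N + Real.log 2 := by
  have hlog2 : 0 < Real.log 2 := Real.log_pos (by norm_num)
  rcases Nat.lt_or_ge 1 N with hN | hN
  · have h := (Nat.pow_pred_clog_lt_self (b := 2) (by norm_num) hN).le
    have hpos := Nat.clog_pos (b := 2) (by norm_num) hN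
    have hcast : ((2 : ℝ) ^ (Nat.clog 2 N).pred) ≤ N := by exact_mod_cast h
    have := Real.log_le_log (by positivity) hcast
    rw [Real.log_pow, Nat.pred_eq_sub_one, Nat.cast_sub hpos] at this
    push_cast at this
    linarith
  · rw [Nat.clog_of_right_le_one hN]
    interval_cases N <;> simp [hlog2.le]

/-- The weight answered by a correct partial protocol is at most the message length. -/
theorem sum_answered_le {A B : Type} [Fintype B] [DecidableEq B] {T : Finset (B → Bool)}
    {w : (B → Bool) → B → ℝ}
    (hw : ∀ (Q : Finset B) (C : Finset (B → Bool)), C ⊆ T →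
        (∀ r ∈ C, ∀ r' ∈ C, ∀ b ∈ Q, r b = r' b) →
        ∑ r ∈ C, Real.exp (∑ b ∈ Q, w r b) ≤ T.card)
    {out ver : A → B → Bool} {m₁ m₂ : ℕ} (hout : HasOneWay out m₁) (hver : HasOneWay ver m₂)
    (a : (B → Bool) → A) (hcorrect : ∀ r ∈ T, ∀ b, ver (a r) b = true → out (a r) b = r b) :
    ∑ r ∈ T, ∑ b, (if ver (a r) b = true then w r b else 0) ≤
      T.card * ((m₁ + m₂ : ℕ) * Real.log 2) := by
  obtain ⟨M₁, o₁, h₁⟩ := hout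
  obtain ⟨M₂, o₂, h₂⟩ := hver
  refine sum_le_of_sum_exp_le _ _ _ ?_
  have hfib : ∀ μ : Fin (2 ^ m₁) × Fin (2 ^ m₂),
      ∑ r ∈ T.filter (fun r => (M₁ (a r), M₂ (a r)) = μ),
        Real.exp (∑ b, (if ver (a r) b = true then w r b else 0)) ≤ T.card := by
    intro μ
    refine le_trans (le_of_eq ?_) (hw (Finset.univ.filter fun b => o₂ μ.2 b = true)
      (T.filter (fun r => (M₁ (a r), M₂ (a r)) = μ)) (Finset.filter_subset _ _) ?_)
    · refine Finset.sum_congr rfl fun r hr => ?_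
      rw [Finset.sum_filter, ← (Finset.mem_filter.mp hr).2]
      simp only [h₂]
    · have hrow : ∀ r ∈ T.filter (fun r => (M₁ (a r), M₂ (a r)) = μ),
          ∀ b ∈ Finset.univ.filter (fun b => o₂ μ.2 b = true), r b = o₁ μ.1 b := by
        intro r hr b hb
        obtain ⟨hrT, rfl⟩ := Finset.mem_filter.mp hr
        rw [Finset.mem_filter] at hb
        rw [← hcorrect r hrT b (by rw [← h₂]; exact hb.2), h₁]
      intro r hr r' hr' b hb
      rw [hrow r hr b hb, hrow r' hr' b hb]
  calc ∑ r ∈ T, Real.exp (∑ b, (if ver (a r) b = true then w r b else 0))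
      = ∑ μ : Fin (2 ^ m₁) × Fin (2 ^ m₂), ∑ r ∈ T.filter (fun r => (M₁ (a r), M₂ (a r)) = μ),
        Real.exp (∑ b, (if ver (a r) b = true then w r b else 0)) :=
        (Finset.sum_fiberwise T (fun r => (M₁ (a r), M₂ (a r))) _).symm
    _ ≤ ∑ _μ : Fin (2 ^ m₁) × Fin (2 ^ m₂), (T.card : ℝ) := Finset.sum_le_sum fun μ _ => hfib μ
    _ = T.card * Real.exp ((m₁ + m₂ : ℕ) * Real.log 2) := by
        rw [Real.exp_nat_mul, Real.exp_log (by norm_num)]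
        simp [pow_add]
        ring

/-- A Las Vegas distribution on one-way protocols has expected cost linear in the deterministic
one-way complexity. -/
theorem Dcc_le_of_lasVegas {A B Ω : Type} [Fintype A] [Fintype B] (g : A → B → Bool)
    (p : PMF Ω) (out ver : Ω → A → B → Bool) (m₁ m₂ : Ω → ℕ)
    (hout : ∀ ω, HasOneWay (out ω) (m₁ ω)) (hver : ∀ ω, HasOneWay (ver ω) (m₂ ω))
    (hcorrect : ∀ ω, p ω ≠ 0 → ∀ a b, ver ω a b = true → out ω a b = g a b)
    (hp : ∀ a b, 1 / 2 ≤ ∑' ω, if ver ω a b = true then p ω else 0) :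
    (Dcc g : ℝ≥0∞) ≤ 2 * (∑' ω, p ω * ((m₁ ω + m₂ ω : ℕ) : ℝ≥0∞)) + 1 := by
  classical
  by_cases htop : (∑' ω, p ω * ((m₁ ω + m₂ ω : ℕ) : ℝ≥0∞)) = ⊤
  · rw [htop, ENNReal.mul_top (by norm_num), top_add]
    exact le_top
  rcases isEmpty_or_nonempty A with hA | hA
  · have hN := Dcc_le_clog g
    simp only [Finset.univ_eq_empty, Finset.image_empty, Finset.card_empty, Nat.clog_zero_right,
      Nat.le_zero] at hN
    simp [hN]
  set T := Finset.univ.image g with hTdef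
  obtain ⟨w, hw0, hw1, hw2⟩ := exists_row_weights T
  have hpre : ∀ r : B → Bool, ∃ a : A, r ∈ T → g a = r := by
    intro r
    by_cases hr : r ∈ T
    · obtain ⟨a, -, ha⟩ := Finset.mem_image.mp hr
      exact ⟨a, fun _ => ha⟩
    · exact ⟨hA.some, fun h => (hr h).elim⟩
  choose a ha using hpre
  have hlog2 : 0 < Real.log 2 := Real.log_pos (by norm_num)
  have key := p.ofReal_mul_sum_le (T ×ˢ Finset.univ) (fun i => w i.1 i.2)
    (fun i hi => hw0 _ (Finset.mem_product.mp hi).1 _)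
    (fun i ω => ver ω (a i.1) i.2 = true) (τ := 1 / 2) (α := T.card * Real.log 2)
    (β := 0) (by norm_num) (by positivity) le_rfl (fun ω => m₁ ω + m₂ ω)
    (fun i _ => by
      refine le_trans (le_of_eq ?_) (hp (a i.1) i.2)
      rw [ENNReal.ofReal_div_of_pos (by norm_num)]
      norm_num)
    (fun ω hω => by
      rw [Finset.sum_product]
      refine (sum_answered_le hw2 (hout ω) (hver ω) a fun r hr b hb => ?_).trans
        (le_of_eq (by ring))
      rw [hcorrect ω hω _ _ hb, ha r hr])
  set e := ∑' ω, p ω * ((m₁ ω + m₂ ω : ℕ) : ℝ≥0∞) with he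
  have hTpos : (0 : ℝ) < T.card := by
    exact_mod_cast Finset.card_pos.mpr ⟨g hA.some, Finset.mem_image_of_mem g (Finset.mem_univ _)⟩
  rw [← ENNReal.ofReal_toReal htop] at key ⊢
  rw [ENNReal.ofReal_zero, add_zero, ← ENNReal.ofReal_mul (by positivity),
    ENNReal.ofReal_le_ofReal_iff (by positivity), Finset.sum_product,
    Finset.sum_congr rfl hw1, Finset.sum_const, nsmul_eq_mul] at key
  have hlogN : Real.log T.card ≤ 2 * e.toReal * Real.log 2 := by
    have h2 : (T.card : ℝ) * Real.log T.card ≤ T.card * (2 * e.toReal * Real.log 2) := by linarith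
    exact le_of_mul_le_mul_left h2 hTpos
  have hD : (Dcc g : ℝ) ≤ 2 * e.toReal + 1 := by
    have h1 : (Dcc g : ℝ) ≤ Nat.clog 2 T.card := by exact_mod_cast Dcc_le_clog g
    have h2 := clog_mul_log_two_le T.card
    refine h1.trans (le_of_mul_le_mul_right ?_ hlog2)
    linarith
  calc (Dcc g : ℝ≥0∞) = ENNReal.ofReal (Dcc g) := (ENNReal.ofReal_natCast _).symm
    _ ≤ ENNReal.ofReal (2 * e.toReal + 1) := ENNReal.ofReal_le_ofReal hD
    _ = _ := by
      rw [ENNReal.ofReal_add (by positivity) (by norm_num), ENNReal.ofReal_mul (by norm_num)]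
      norm_num

section Blocks

variable {n k : ℕ} (y : Fin n → Fin k) (i : Fin k)

instance : Fintype (AliceT y i) := by unfold AliceT; infer_instance

instance : Fintype (BobT y i) := by unfold BobT; infer_instance

instance : Nonempty (AliceT y i) := by unfold AliceT; infer_instance

/-- A formula gives a one-way protocol for the communication problem of each block. -/
theorem BFormula.hasOneWay_combine (F : BFormula (Fin n)) :
    HasOneWay (fun a b => F.eval (combine y i a b))
      (4 * F.sizeP (fun v => decide (y v = i)) + 2) := by
  refine F.hasOneWay _ (fun a b => combine y i a b) (fun v hv a b b' => ?_) fun v hv a a' b => ?_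
  · simp only [decide_eq_false_iff_not] at hv
    simp [combine, hv]
  · simp only [decide_eq_true_eq] at hv
    simp [combine, hv]

/-- The VC dimension of the communication problem of a block is attained. -/
theorem exists_shatters_card_eq_VCdim (f : (Fin n → Bool) → Bool) :
    ∃ S, Shatters (game f y i) S ∧ S.card = VCdim (game f y i) := by
  refine Nat.sSup_mem (s := {d | ∃ S, Shatters (game f y i) S ∧ S.card = d})
    ⟨0, ∅, fun R hR => ?_, rfl⟩ ⟨Fintype.card (BobT y i), ?_⟩
  · exact ⟨Classical.arbitrary _, by simp⟩
  · rintro d ⟨S, -, rfl⟩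
    exact S.card_le_univ

theorem PMF.tsum_mul_affine {Ω : Type} (p : PMF Ω) (m : Ω → ℕ) (α β : ℕ) :
    ∑' ω, p ω * ((α * m ω + β : ℕ) : ℝ≥0∞) = α * (∑' ω, p ω * (m ω : ℝ≥0∞)) + β := by
  have hterm : ∀ ω, p ω * ((α * m ω + β : ℕ) : ℝ≥0∞) = α * (p ω * (m ω : ℝ≥0∞)) + p ω * β := by
    intro ω
    push_cast
    ring
  simp only [hterm]
  rw [ENNReal.tsum_add, ENNReal.tsum_mul_left, ENNReal.tsum_mul_right, p.tsum_coe, one_mul]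

theorem ofReal_div_sixty_le {d : ℕ} {e : ℝ≥0∞} (h : (d : ℝ≥0∞) ≤ 60 * e + 60) :
    ENNReal.ofReal (1 / 60 * d) ≤ e + 1 := by
  rw [ENNReal.ofReal_mul (by norm_num), ENNReal.ofReal_natCast,
    ENNReal.ofReal_div_of_pos (by norm_num)]
  calc _ ≤ ENNReal.ofReal 1 / ENNReal.ofReal 60 * (60 * e + 60) := mul_le_mul_right h _
    _ = (60⁻¹ * 60) * (e + 1) := by simp; ring
    _ = e + 1 := by rw [ENNReal.inv_mul_cancel (by norm_num) (by norm_num), one_mul]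

/-- Block-wise bounds add up. -/
theorem ofReal_sum_le_of_blocks {Ω : Type} (p : PMF Ω) (m : Fin k → Ω → ℕ) (d : Fin k → ℕ)
    (h : ∀ j, (d j : ℝ≥0∞) ≤ 60 * (∑' ω, p ω * (m j ω : ℝ≥0∞)) + 60) :
    ENNReal.ofReal (1 / 60 * ∑ j, (d j : ℝ)) ≤
      (∑' ω, p ω * ((∑ j, m j ω : ℕ) : ℝ≥0∞)) + k := by
  rw [Finset.mul_sum, ENNReal.ofReal_sum_of_nonneg fun _ _ => by positivity]
  refine (Finset.sum_le_sum fun j _ => ofReal_div_sixty_le (h j)).trans (le_of_eq ?_)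
  rw [Finset.sum_add_distrib, ← Summable.tsum_finsetSum fun _ _ => ENNReal.summable]
  simp [Finset.mul_sum]

end Blocks

/-- The VC-Ne\v ciporuk function is (up to a constant) a lower bound on the size of
strong bounded-error probabilistic formulas, and the standard Ne\v ciporuk function
is a lower bound on the size of strong Las Vegas formulas. -/
theorem stmt1 :
    ∃ c : ℝ, 0 < c ∧
      ∀ (n k : ℕ) (f : (Fin n → Bool) → Bool) (y : Fin n → Fin k),
        Function.Surjective y →
        (∀ p : PMF (BFormula (Fin n)), ComputesBdd p f →
          ENNReal.ofReal (c * ∑ i : Fin k, (VCdim (game f y i) : ℝ)) ≤ pmfSize p + k) ∧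
        (∀ p : PMF (BFormula (Fin n) × BFormula (Fin n)), ComputesLV p f →
          ENNReal.ofReal (c * ∑ i : Fin k, (Dcc (game f y i) : ℝ)) ≤ lvSize p + k) := by
  refine ⟨1 / 60, by norm_num, fun n k f y _ => ⟨fun p hp => ?_, fun p hp => ?_⟩⟩
  · have h := ofReal_sum_le_of_blocks p
      (fun i F => F.sizeP (fun v => decide (y v = i))) (fun i => VCdim (game f y i)) fun i => by
        obtain ⟨S, hS, hcard⟩ := exists_shatters_card_eq_VCdim y i f
        have hle := hS.card_le p _ _ (fun F => F.hasOneWay_combine y i)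
          (fun a b => hp (combine y i a b))
        rw [hcard, p.tsum_mul_affine] at hle
        refine hle.trans ?_
        rw [mul_add, ← mul_assoc]
        gcongr <;> norm_num
    simpa only [BFormula.sum_sizeP, pmfSize] using h
  · have h := ofReal_sum_le_of_blocks p
      (fun i q => q.1.sizeP (fun v => decide (y v = i)) + q.2.sizeP (fun v => decide (y v = i)))
      (fun i => Dcc (game f y i)) fun i => by
        have hle := Dcc_le_of_lasVegas (game f y i) p _ _ _ _
          (fun q => q.1.hasOneWay_combine y i) (fun q => q.2.hasOneWay_combine y i)
          (fun q hq a b hv => by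
            by_contra hne
            have h0 := ENNReal.tsum_eq_zero.mp (hp (combine y i a b)).1 q
            rw [if_pos ⟨hv, hne⟩] at h0
            exact hq h0)
          (fun a b => by
            have h1 : (1 : ℝ≥0∞) = (∑' q, if q.2.eval (combine y i a b) = true then p q else 0) +
                ∑' q, if q.2.eval (combine y i a b) = false then p q else 0 := by
              rw [← p.tsum_coe, ← ENNReal.tsum_add]
              refine tsum_congr fun q => ?_
              cases q.2.eval (combine y i a b) <;> simp
            have h2 := h1.le.trans (add_le_add_right (hp (combine y i a b)).2 _)
            nth_rewrite 1 [← ENNReal.add_halves 1] at h2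
            exact (ENNReal.add_le_add_iff_right (a := 1 / 2) (by norm_num)).mp h2)
        have hm : ∀ q : BFormula (Fin n) × BFormula (Fin n),
            4 * q.1.sizeP (fun v => decide (y v = i)) + 2 +
              (4 * q.2.sizeP (fun v => decide (y v = i)) + 2) =
            4 * (q.1.sizeP (fun v => decide (y v = i)) +
              q.2.sizeP (fun v => decide (y v = i))) + 4 := fun q => by ring
        simp only [hm] at hle
        rw [p.tsum_mul_affine] at hle
        refine hle.trans ?_
        rw [mul_add, ← mul_assoc, add_assoc]
        gcongr <;> norm_num
    simpa only [Finset.sum_add_distrib, BFormula.sum_sizeP, lvSize] using h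
end

section
/- Let n ≥ 2 and let f : {0,1}^n → {0,1} be a total function that depends on each of its n variables. Then every strong probabilistic formula computing f with bounded error has size at least n/4. -/
open scoped ENNReal

namespace BFormula

variable {V : Type} [DecidableEq V]

/-- A formula's value is unchanged by updating a variable that labels none of its leaves. -/
theorem eval_update_of_sizeP_eq_zero (x : V → Bool) (i : V) (b : Bool) (F : BFormula V)
    (h : F.sizeP (fun j => decide (j = i)) = 0) :
    F.eval (Function.update x i b) = F.eval x := by
  induction F with
  | var v =>
    have hv : v ≠ i := by simpa [sizeP] using h
    simp [eval, hv]
  | const c => rfl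
  | node g l r hl hr =>
    obtain ⟨h₁, h₂⟩ := Nat.add_eq_zero_iff.mp h
    simp only [eval, hl h₁, hr h₂]

/-- The size of a formula is the sum over all variables of their numbers of occurrences. -/
theorem size_eq_sum_sizeP [Fintype V] (F : BFormula V) :
    F.size = ∑ i : V, F.sizeP (fun j => decide (j = i)) := by
  unfold size
  induction F with
  | var v => simp [sizeP]
  | const c => simp [sizeP]
  | node g l r hl hr => simp only [sizeP, hl, hr, Finset.sum_add_distrib]

end BFormula

/-- The expected number of occurrences of a relevant variable in a strong probabilistic formula
computing `f` with bounded error is at least `1/3`. -/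
theorem ComputesBdd.third_le_expected_sizeP {V : Type} [DecidableEq V] {p : PMF (BFormula V)}
    {f : (V → Bool) → Bool} (hp : ComputesBdd p f) {i : V} {x : V → Bool}
    (hx : f (Function.update x i true) ≠ f (Function.update x i false)) :
    1 / 3 ≤ ∑' F, p F * (F.sizeP (fun j => decide (j = i)) : ℝ≥0∞) := by
  have hle : (2 / 3 + 2 / 3 : ℝ≥0∞) ≤
      1 + ∑' F, p F * (F.sizeP (fun j => decide (j = i)) : ℝ≥0∞) := by
    refine (add_le_add (hp (Function.update x i true)) (hp (Function.update x i false))).trans ?_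
    rw [← p.tsum_coe, ← ENNReal.tsum_add, ← ENNReal.tsum_add]
    refine ENNReal.tsum_le_tsum fun F => ?_
    rcases Nat.eq_zero_or_pos (F.sizeP (fun j => decide (j = i))) with h | h
    · rw [F.eval_update_of_sizeP_eq_zero x i _ h, F.eval_update_of_sizeP_eq_zero x i _ h]
      by_cases h₁ : F.eval x = f (Function.update x i true)
      · have h₂ : F.eval x ≠ f (Function.update x i false) := h₁ ▸ hx
        rw [if_pos h₁, if_neg h₂, add_zero]
        exact le_self_add
      · rw [if_neg h₁, zero_add]
        split_ifs
        · exact le_self_add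
        · exact zero_le
    · refine add_le_add ?_ ?_
      · split_ifs
        · exact le_rfl
        · exact zero_le
      · split_ifs
        · exact le_mul_of_one_le_right' (by exact_mod_cast h)
        · exact zero_le
  have heq : (2 / 3 + 2 / 3 : ℝ≥0∞) = 1 + 1 / 3 := by
    rw [← ENNReal.toReal_eq_toReal_iff' (by finiteness) (by finiteness)]
    rw [ENNReal.toReal_add (by finiteness) (by finiteness),
      ENNReal.toReal_add (by finiteness) (by finiteness)]
    simp only [ENNReal.toReal_div, ENNReal.toReal_ofNat, ENNReal.toReal_one]
    norm_num
  rw [heq] at hle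
  exact (ENNReal.add_le_add_iff_left ENNReal.one_ne_top).mp hle

/-- Every strong probabilistic formula computing with bounded error a total function
depending on all of its `n ≥ 2` variables has size at least `n/4`. -/
theorem stmt3 {n : ℕ} (hn : 2 ≤ n) (f : (Fin n → Bool) → Bool)
    (hdep : ∀ i : Fin n, ∃ x : Fin n → Bool,
      f (Function.update x i true) ≠ f (Function.update x i false))
    (p : PMF (BFormula (Fin n))) (hp : ComputesBdd p f) :
    (n : ℝ≥0∞) / 4 ≤ pmfSize p := by
  calc (n : ℝ≥0∞) / 4 ≤ (n : ℝ≥0∞) / 3 :=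
        ENNReal.div_le_div_left (by norm_num) _
    _ = ∑ _i : Fin n, (1 / 3 : ℝ≥0∞) := by
        simp [div_eq_mul_inv]
    _ ≤ ∑ i : Fin n, ∑' F, p F * (F.sizeP (fun j => decide (j = i)) : ℝ≥0∞) :=
        Finset.sum_le_sum fun i _ =>
          let ⟨_, hx⟩ := hdep i
          hp.third_le_expected_sizeP hx
    _ = pmfSize p := by
        rw [← Summable.tsum_finsetSum fun i _ => ENNReal.summable]
        simp only [pmfSize, BFormula.size_eq_sum_sizeP, Nat.cast_sum, Finset.mul_sum]
end

section
/- Let S be a finite set, let ⊥ ∉ S, let X and Y be random variables on a common probability space with X taking values in S and Y taking values in S ∪ {⊥}, and let 0 ≤ ε ≤ 1. Assume that for every x ∈ S: Pr(Y = x and X ≠ x) = 0 and Pr(Y = x and X = x) ≥ (1−ε)·Pr(X = x). Then H(X:Y) ≥ (1−ε)·H(X). -/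
/-- The function `x ↦ -x·log₂ x` (with the convention `0·log₂ 0 = 0`,
which holds automatically since `Real.logb 2 0 = 0`). -/
noncomputable def ent (x : ℝ) : ℝ := -(x * Real.logb 2 x)

/-- Shannon entropy of a finitely supported distribution. -/
noncomputable def Hent {α : Type} [Fintype α] (p : α → ℝ) : ℝ := ∑ a, ent (p a)

open Real in
/-- Termwise Gibbs inequality for a sub-distribution dominated by `ε • q`. -/
lemma neg_mul_log_add_mul_log_le {s q b ε : ℝ} (hs : 0 ≤ s) (hsq : s ≤ ε * q) (hq : 0 ≤ q)
    (hq1 : q ≤ 1) (hsb : s ≤ b) (hε : 0 ≤ ε) :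
    -(s * log s) + s * log b ≤ ε * -(q * log q) + (b * q - s) := by
  have hlogq : log q ≤ 0 := log_nonpos hq hq1
  rcases hs.eq_or_lt with rfl | hs
  · have h1 : 0 ≤ ε * -(q * log q) :=
      mul_nonneg hε (neg_nonneg.2 (mul_nonpos_of_nonneg_of_nonpos hq hlogq))
    have h2 : 0 ≤ b * q := mul_nonneg hsb hq
    simp only [zero_mul, neg_zero, zero_add, sub_zero]
    linarith
  · have hb : 0 < b := hs.trans_le hsb
    have hq : 0 < q := hq.lt_of_ne (by rintro rfl; simp only [mul_zero] at hsq; linarith)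
    have h := mul_le_mul_of_nonneg_left (log_le_sub_one_of_pos (div_pos (mul_pos hb hq) hs)) hs.le
    rw [log_div (mul_pos hb hq).ne' hs.ne', log_mul hb.ne' hq.ne', mul_sub, mul_sub, mul_add,
      mul_div_cancel₀ _ hs.ne'] at h
    nlinarith [mul_le_mul_of_nonneg_right hsq (neg_nonneg.2 hlogq)]

lemma ent_eq_div_log_two (x : ℝ) : ent x = -(x * Real.log x) / Real.log 2 := by
  rw [ent, Real.logb]
  ring

lemma ent_zero : ent 0 = 0 := by
  simp [ent]

/-- Discarding part of a random variable: the entropy of a sub-distribution dominated by `ε • q`,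
relative to its total mass, is at most `ε` times the entropy of `q`. -/
lemma Hent_le_mul_Hent_add_ent_sum {S : Type} [Fintype S] {q b : S → ℝ} {ε : ℝ}
    (hb : ∀ x, 0 ≤ b x) (hbq : ∀ x, b x ≤ ε * q x) (hq : ∀ x, 0 ≤ q x)
    (hq1 : ∑ x, q x = 1) (hε : 0 ≤ ε) :
    Hent b ≤ ε * Hent q + ent (∑ x, b x) := by
  have h := Finset.sum_le_sum fun x (_ : x ∈ Finset.univ) =>
    neg_mul_log_add_mul_log_le (hb x) (hbq x) (hq x)
      (hq1 ▸ Finset.single_le_sum (fun i _ => hq i) (Finset.mem_univ x))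
      (Finset.single_le_sum (fun i _ => hb i) (Finset.mem_univ x)) hε
  rw [Finset.sum_add_distrib, Finset.sum_add_distrib, Finset.sum_sub_distrib, ← Finset.mul_sum,
    ← Finset.mul_sum, ← Finset.sum_mul, hq1] at h
  simp only [Hent, ent_eq_div_log_two, ← Finset.sum_div]
  rw [mul_div_assoc', ← add_div]
  gcongr
  linarith

/-- If `Y` never outputs a wrong value of `X` (it may output `⊥ = none` instead),
and outputs the correct value with probability at least `1 − ε` conditioned on each
value, then the mutual information `H(X:Y) = H(X) + H(Y) − H(X,Y)` is at least
`(1−ε)·H(X)`. Here `p` is the joint distribution of `(X,Y)` on `S × (S ∪ {⊥})`. -/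
theorem stmt8 {S : Type} [Fintype S] (p : S × Option S → ℝ) (ε : ℝ)
    (hp0 : ∀ z, 0 ≤ p z) (hp1 : ∑ z, p z = 1) (hε0 : 0 ≤ ε) (hε1 : ε ≤ 1)
    (hnowrong : ∀ x x' : S, x' ≠ x → p (x', some x) = 0)
    (hcorrect : ∀ x : S, (1 - ε) * (∑ y, p (x, y)) ≤ p (x, some x)) :
    (1 - ε) * Hent (fun x : S => ∑ y, p (x, y)) ≤
      Hent (fun x : S => ∑ y, p (x, y)) +
        Hent (fun y : Option S => ∑ x, p (x, y)) - Hent p := by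
  classical
  have sum_row (f : ℝ → ℝ) (hf : f 0 = 0) (x : S) :
      ∑ y, f (p (x, y)) = f (p (x, none)) + f (p (x, some x)) := by
    rw [Fintype.sum_option, Fintype.sum_eq_single x]
    intro y hy
    rw [hnowrong y x hy.symm, hf]
  have sum_col (x : S) : ∑ x', p (x', some x) = p (x, some x) :=
    Fintype.sum_eq_single x fun x' hx' => hnowrong x x' hx'
  have hrow (x : S) : ∑ y, p (x, y) = p (x, none) + p (x, some x) := sum_row id rfl x
  have hjoint : Hent p = Hent (fun x => p (x, none)) + Hent (fun x => p (x, some x)) := by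
    simp only [Hent, Fintype.sum_prod_type, sum_row ent ent_zero, Finset.sum_add_distrib]
  have hY : Hent (fun y : Option S => ∑ x, p (x, y)) =
      ent (∑ x, p (x, none)) + Hent (fun x => p (x, some x)) := by
    simp only [Hent, Fintype.sum_option, sum_col]
  have key := Hent_le_mul_Hent_add_ent_sum (q := fun x => ∑ y, p (x, y))
    (b := fun x => p (x, none)) (ε := ε) (fun x => hp0 _)
    (fun x => by linarith [hcorrect x, hrow x])
    (fun x => Finset.sum_nonneg fun y _ => hp0 _)
    (by rw [← hp1, Fintype.sum_prod_type]) hε0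
  rw [hjoint, hY]
  linarith
end

section
/- There exist constants ε > 0, c > 0 and integers s₀, n₀ such that for all n ≥ n₀ and all s with s₀ ≤ s ≤ n: every nondeterministic one-way protocol computing the communication problem D_{n,s} using ⌊ε·s⌋ nondeterministic bits has cost at least c·n·s·log₂ n. -/
/-- The communication problem `D_{n,s}`: Alice holds `n` tuples of `s` elements of
`{1,…,n³}` and Bob one more such tuple; the answer is 1 iff all `n+1` tuples consist
of pairwise distinct elements (describe `s`-element sets) and some set intersects at
least `s` of the other sets. -/
def DnsProp (n s : ℕ) (a : Fin n → Fin s → Fin (n ^ 3))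
    (b : Fin s → Fin (n ^ 3)) : Prop :=
  let x : Fin (n + 1) → Fin s → Fin (n ^ 3) := Fin.snoc a b
  (∀ i, Function.Injective (x i)) ∧
  ∃ i : Fin (n + 1), s ≤ (Finset.univ.filter
    (fun j : Fin (n + 1) => j ≠ i ∧ ∃ u v : Fin s, x i u = x j v)).card

/-- The AM-GM inequality for natural numbers, without division. -/
lemma card_pow_mul_prod_le_sum_pow {s : ℕ} (hs : 0 < s) (z : Fin s → ℕ) :
    s ^ s * ∏ k, z k ≤ (∑ k, z k) ^ s := by
  have hs' : (0 : ℝ) < s := by exact_mod_cast hs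
  have h := Real.geom_mean_le_arith_mean Finset.univ (fun _ : Fin s => (1 : ℝ))
    (fun k => (z k : ℝ)) (fun _ _ => zero_le_one) (by simpa using hs)
    (fun k _ => Nat.cast_nonneg _)
  simp only [Real.rpow_one, one_mul, Finset.sum_const, Finset.card_univ, Fintype.card_fin,
    nsmul_eq_mul, mul_one] at h
  have hp : (0 : ℝ) ≤ ∏ k, (z k : ℝ) := Finset.prod_nonneg fun k _ => Nat.cast_nonneg _
  have h2 := pow_le_pow_left₀ (Real.rpow_nonneg hp _) h s
  rw [Real.rpow_inv_natCast_pow hp hs.ne', div_pow, le_div_iff₀ (by positivity)] at h2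
  rw [mul_comm]
  exact_mod_cast h2

/-- An injective Alice input yields value 1 on every transversal. -/
lemma dnsProp_of_transversal {n s : ℕ} (f : Fin n × Fin s ↪ Fin (n ^ 3))
    (σ : Fin s → Fin n) (hσ : Function.Injective σ) (τ : Fin s → Fin s) :
    DnsProp n s (fun i j => f (i, j)) (fun k => f (σ k, τ k)) := by
  refine ⟨fun i => ?_, Fin.last n, ?_⟩
  · refine Fin.lastCases ?_ (fun i => ?_) i
    · intro k l h
      simp only [Fin.snoc_last] at h
      exact hσ (congrArg Prod.fst (f.injective h))
    · intro k l h
      simp only [Fin.snoc_castSucc] at h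
      exact congrArg Prod.snd (f.injective h)
  · have hinj : Function.Injective fun k => (σ k).castSucc :=
      (Fin.castSucc_injective n).comp hσ
    calc s = (Finset.univ.map ⟨fun k => (σ k).castSucc, hinj⟩).card := by simp
      _ ≤ _ := Finset.card_le_card ?_
    intro j hj
    obtain ⟨k, -, rfl⟩ := Finset.mem_map.1 hj
    simp only [Function.Embedding.coeFn_mk, Finset.mem_filter, Finset.mem_univ, true_and]
    refine ⟨(Fin.castSucc_lt_last _).ne, k, τ k, ?_⟩
    simp

/-- If Alice's sets are pairwise disjoint, an accepted Bob input lies in their union. -/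
lemma mem_range_of_dnsProp {n s : ℕ} (hs : 2 ≤ s) (f : Fin n × Fin s ↪ Fin (n ^ 3))
    (b : Fin s → Fin (n ^ 3)) (h : DnsProp n s (fun i j => f (i, j)) b) (k : Fin s) :
    b k ∈ Set.range f := by
  obtain ⟨-, i, hi⟩ := h
  revert hi
  refine Fin.lastCases (fun hi => ?_) (fun i hi => ?_) i
  · by_contra hk
    have hsub : (Finset.univ.filter (fun j : Fin (n + 1) => j ≠ Fin.last n ∧ ∃ u v : Fin s,
        (Fin.snoc (fun i j => f (i, j)) b : Fin (n + 1) → Fin s → Fin (n ^ 3)) (Fin.last n) u =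
        (Fin.snoc (fun i j => f (i, j)) b : Fin (n + 1) → Fin s → Fin (n ^ 3)) j v)).card ≤
        (Finset.univ.erase k).card := by
      refine Finset.card_le_card_of_forall_subsingleton
        (fun j u => ∃ v, b u =
          (Fin.snoc (fun i j => f (i, j)) b : Fin (n + 1) → Fin s → Fin (n ^ 3)) j v) ?_ ?_
      · intro j hj
        obtain ⟨hjl, u, v, huv⟩ := (Finset.mem_filter.1 hj).2
        rw [Fin.snoc_last] at huv
        refine ⟨u, Finset.mem_erase.2 ⟨?_, Finset.mem_univ _⟩, v, huv⟩
        rintro rfl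
        obtain ⟨j, rfl⟩ := Fin.exists_castSucc_eq.2 hjl
        rw [Fin.snoc_castSucc] at huv
        exact hk ⟨_, huv.symm⟩
      · rintro u - j ⟨hj, v, hv⟩ j' ⟨hj', v', hv'⟩
        have hjl := (Finset.mem_filter.1 hj).2.1
        have hjl' := (Finset.mem_filter.1 hj').2.1
        obtain ⟨j, rfl⟩ := Fin.exists_castSucc_eq.2 hjl
        obtain ⟨j', rfl⟩ := Fin.exists_castSucc_eq.2 hjl'
        rw [Fin.snoc_castSucc] at hv hv'
        exact congrArg (fun q => q.1.castSucc) (f.injective (hv.symm.trans hv'))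
    have hlt := Finset.card_erase_lt_of_mem (Finset.mem_univ k)
    rw [Finset.card_univ, Fintype.card_fin] at hlt
    omega
  · exfalso
    have : s ≤ ({Fin.last n} : Finset (Fin (n + 1))).card := hi.trans (Finset.card_le_card ?_)
    · simp at this; omega
    intro j hj
    obtain ⟨hji, u, v, huv⟩ := (Finset.mem_filter.1 hj).2
    rw [Finset.mem_singleton]
    by_contra hjl
    obtain ⟨j, rfl⟩ := Fin.exists_castSucc_eq.2 hjl
    rw [Fin.snoc_castSucc, Fin.snoc_castSucc] at huv
    exact hji (congrArg (fun q => q.1.castSucc) (f.injective huv)).symm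

/-- The number of embeddings whose range contains a given set. -/
lemma card_embedding_range_superset_le {α β : Type*} [Fintype α] [Fintype β] [DecidableEq α]
    [DecidableEq β] (U : Finset β) (F : Finset (α ↪ β))
    (hF : ∀ f ∈ F, ∀ v ∈ U, v ∈ Set.range f) :
    F.card ≤ Fintype.card α ^ U.card * Fintype.card β ^ (Fintype.card α - U.card) := by
  classical
  have hsub : F.map ⟨fun f : α ↪ β => (f : α → β), DFunLike.coe_injective⟩ ⊆
      (Finset.univ : Finset (U → α)).biUnion
        fun r => Finset.univ.filter fun g : α → β => ∀ v, g (r v) = v := by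
    intro g hg
    obtain ⟨f, hf, rfl⟩ := Finset.mem_map.1 hg
    choose r hr using fun v : U => hF f hf v v.2
    exact Finset.mem_biUnion.2 ⟨r, Finset.mem_univ _, by simpa using fun v hv => hr ⟨v, hv⟩⟩
  have hr : ∀ r : U → α, (Finset.univ.filter fun g : α → β => ∀ v, g (r v) = v).card ≤
      Fintype.card β ^ (Fintype.card α - U.card) := by
    intro r
    by_cases hinj : Function.Injective r
    · set R := Finset.univ.image r
      have hR : R.card = U.card := by
        rw [Finset.card_image_of_injective _ hinj]; simp
      calc _ ≤ Fintype.card ((Rᶜ : Finset α) → β) := by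
            rw [← Finset.card_univ]
            refine Finset.card_le_card_of_injOn (fun g x => g x)
              (fun _ _ => Finset.mem_coe.2 (Finset.mem_univ _)) ?_
            intro g hg g' hg' h
            have hg := (Finset.mem_filter.1 hg).2
            have hg' := (Finset.mem_filter.1 hg').2
            funext x
            by_cases hx : x ∈ R
            · obtain ⟨v, -, rfl⟩ := Finset.mem_image.1 hx
              rw [hg, hg']
            · exact congrFun h ⟨x, Finset.mem_compl.2 hx⟩
        _ = _ := by simp [hR]
    · rw [Finset.filter_eq_empty_iff.2]
      · simp
      · intro g _ hg
        exact hinj fun v w h => Subtype.ext (by rw [← hg v, ← hg w, h])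
  calc F.card = _ := (Finset.card_map _).symm
    _ ≤ _ := Finset.card_le_card hsub
    _ ≤ _ := Finset.card_biUnion_le_card_mul _ _ _ fun r _ => hr r
    _ = _ := by simp

/-- Points occurring in Bob inputs accepted on a message `m`. -/
noncomputable def acceptedPoints {N s : ℕ} (om : (Fin s → Fin N) → Bool) : Finset (Fin N) :=
  open Classical in Finset.univ.filter fun v => ∃ b, om b = true ∧ ∃ k, b k = v

/-- For every injective Alice input some nondeterministic guess leads to a message whose accepted
points make up a quarter of all `n * s` points of the input. -/
lemma exists_guess_le_card_acceptedPoints {n s C : ℕ} (hs : 2 ≤ s) (hsn : s ≤ n)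
    (m : (Fin s → Bool) → Fin C) (o : Fin C → (Fin s → Fin (n ^ 3)) → Bool)
    (f : Fin n × Fin s ↪ Fin (n ^ 3))
    (h : ∀ b, DnsProp n s (fun i j => f (i, j)) b → ∃ w, o (m w) b = true) :
    ∃ w, n * s ≤ 4 * (acceptedPoints (o (m w))).card := by
  classical
  set g := n / s
  have hg : s * g ≤ n := Nat.mul_div_le n s
  have hg1 : 1 ≤ g := (Nat.one_le_div_iff (by omega)).2 hsn
  have hg2 : n ≤ 2 * (g * s) := by
    have h1 : n < s * g + s := by
      simpa [Nat.mul_add] using Nat.lt_mul_div_succ n (show 0 < s by omega)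
    nlinarith
  let e : Fin s × Fin g ↪ Fin n := finProdFinEquiv.toEmbedding.trans (Fin.castLEEmb hg)
  let bt : (Fin s → Fin g × Fin s) → Fin s → Fin (n ^ 3) := fun t k => f (e (k, (t k).1), (t k).2)
  have hcov : ∀ t, ∃ w, o (m w) (bt t) = true := fun t => h _ <|
    dnsProp_of_transversal f (fun k => e (k, (t k).1))
      (fun k l hkl => congrArg Prod.fst (e.injective hkl)) fun k => (t k).2
  obtain ⟨w, hw⟩ : ∃ w, (g * s) ^ s ≤
      2 ^ s * (Finset.univ.filter fun t => o (m w) (bt t) = true).card := by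
    by_contra! hcon
    have h1 : (Finset.univ : Finset (Fin s → Fin g × Fin s)) ⊆
        (Finset.univ : Finset (Fin s → Bool)).biUnion
          fun w => Finset.univ.filter fun t => o (m w) (bt t) = true := by
      intro t _
      obtain ⟨w, hw⟩ := hcov t
      exact Finset.mem_biUnion.2 ⟨w, Finset.mem_univ _, by simpa using hw⟩
    have h2 := (Finset.card_le_card h1).trans Finset.card_biUnion_le
    have h3 : ∑ w : Fin s → Bool, 2 ^ s * (Finset.univ.filter fun t => o (m w) (bt t) = true).card <
        ∑ w : Fin s → Bool, (g * s) ^ s :=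
      Finset.sum_lt_sum_of_nonempty Finset.univ_nonempty fun w _ => hcon w
    rw [← Finset.mul_sum] at h3
    simp only [Finset.card_univ, Fintype.card_fun, Fintype.card_prod, Fintype.card_fin,
      Fintype.card_bool, Finset.sum_const, smul_eq_mul] at h2 h3
    exact absurd (Nat.lt_of_mul_lt_mul_left h3) (not_lt.2 h2)
  refine ⟨w, ?_⟩
  set U := acceptedPoints (o (m w))
  let S : Fin s → Finset (Fin g × Fin s) := fun k =>
    Finset.univ.filter fun q => f (e (k, q.1), q.2) ∈ U
  have hS : (Finset.univ.filter fun t => o (m w) (bt t) = true).card ≤ ∏ k, (S k).card := by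
    rw [← Fintype.card_piFinset]
    refine Finset.card_le_card fun t ht => Fintype.mem_piFinset.2 fun k => ?_
    simp only [S, Finset.mem_filter, Finset.mem_univ, true_and, U, acceptedPoints]
    exact ⟨bt t, (Finset.mem_filter.1 ht).2, k, rfl⟩
  have hsum : ∑ k, (S k).card ≤ U.card := by
    rw [← Finset.card_sigma]
    refine Finset.card_le_card_of_injOn (fun x => f (e (x.1, x.2.1), x.2.2)) ?_ ?_
    · intro x hx
      simpa [S] using hx
    · rintro ⟨k, q⟩ - ⟨k', q'⟩ - hx
      have h1 := f.injective hx
      have h2 := e.injective (congrArg Prod.fst h1)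
      have h3 := congrArg Prod.snd h1
      simp only [Prod.mk.injEq] at h2 h3
      obtain ⟨rfl, h2⟩ := h2
      rw [Prod.ext h2 h3]
  have hpow : (s * (g * s)) ^ s ≤ (2 * ∑ k, (S k).card) ^ s := by
    calc (s * (g * s)) ^ s = s ^ s * (g * s) ^ s := mul_pow _ _ _
      _ ≤ s ^ s * (2 ^ s * ∏ k, (S k).card) := by gcongr; exact hw.trans (by gcongr)
      _ = 2 ^ s * (s ^ s * ∏ k, (S k).card) := by ring
      _ ≤ 2 ^ s * (∑ k, (S k).card) ^ s := by
        gcongr; exact card_pow_mul_prod_le_sum_pow (by omega) _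
      _ = _ := (mul_pow _ _ _).symm
  have := (Nat.pow_le_pow_iff_left (by omega)).1 hpow
  nlinarith

/-- The counting bound relating the number of messages to the number of embeddings. -/
lemma exists_pow_le_two_pow {n s cc : ℕ} (hs : 2 ≤ s) (hsn : s ≤ n)
    (M : (Fin n → Fin s → Fin (n ^ 3)) → (Fin s → Bool) → Fin (2 ^ cc))
    (o : Fin (2 ^ cc) → (Fin s → Fin (n ^ 3)) → Bool)
    (h : ∀ a b, DnsProp n s a b ↔ ∃ w, o (M a w) b = true) :
    ∃ u, n * s ≤ 4 * u ∧ n ^ u ≤ 2 ^ (n * s + cc) := by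
  classical
  choose w hw using fun f : Fin n × Fin s ↪ Fin (n ^ 3) =>
    exists_guess_le_card_acceptedPoints hs hsn (M fun i j => f (i, j)) o f fun b => (h _ b).1
  have hns : n * s ≤ n ^ 2 := by nlinarith
  have hn2 : n ^ 2 * 2 ≤ n ^ 3 := by
    rw [pow_succ n 2]; exact Nat.mul_le_mul_left _ (hs.trans hsn)
  have hcard : Fintype.card (Fin n × Fin s ↪ Fin (n ^ 3)) = (n ^ 3).descFactorial (n * s) := by
    simp [Fintype.card_embedding_eq]
  have hdesc : (n ^ 3) ^ (n * s) ≤ 2 ^ (n * s) * Fintype.card (Fin n × Fin s ↪ Fin (n ^ 3)) := by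
    rw [hcard]
    calc (n ^ 3) ^ (n * s) ≤ (2 * (n ^ 3 + 1 - n * s)) ^ (n * s) :=
          Nat.pow_le_pow_left (by omega) _
      _ = 2 ^ (n * s) * (n ^ 3 + 1 - n * s) ^ (n * s) := mul_pow _ _ _
      _ ≤ _ := Nat.mul_le_mul_left _ (Nat.pow_sub_le_descFactorial _ _)
  let msg : (Fin n × Fin s ↪ Fin (n ^ 3)) → Fin (2 ^ cc) := fun f => M (fun i j => f (i, j)) (w f)
  have : Nonempty (Fin n × Fin s ↪ Fin (n ^ 3)) := by
    rw [← Fintype.card_pos_iff]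
    refine Nat.pos_of_ne_zero fun h0 => ?_
    rw [h0, mul_zero] at hdesc
    have : 0 < n := by omega
    exact absurd hdesc (not_le.2 (by positivity))
  obtain ⟨μ, -, hμ⟩ : ∃ μ ∈ (Finset.univ : Finset (Fin (2 ^ cc))),
      Fintype.card (Fin n × Fin s ↪ Fin (n ^ 3)) ≤
        2 ^ cc * (Finset.univ.filter fun f => msg f = μ).card := by
    have h1 := Finset.card_eq_sum_card_fiberwise (f := msg) (s := Finset.univ) (t := Finset.univ)
      fun _ _ => Finset.mem_coe.2 (Finset.mem_univ _)
    refine Finset.exists_le_of_sum_le Finset.univ_nonempty ?_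
    rw [← Finset.mul_sum, ← h1]
    simp
  have hpos : 0 < Fintype.card (Fin n × Fin s ↪ Fin (n ^ 3)) := Fintype.card_pos
  obtain ⟨f₀, hf₀⟩ : (Finset.univ.filter fun f => msg f = μ).Nonempty := by
    rw [← Finset.card_pos]
    exact Nat.pos_of_mul_pos_left (hpos.trans_le hμ)
  have hsup : ∀ f ∈ Finset.univ.filter (fun f => msg f = μ), ∀ v ∈ acceptedPoints (o μ),
      v ∈ Set.range f := by
    intro f hf v hv
    obtain ⟨b, hb, k, rfl⟩ := (Finset.mem_filter.1 hv).2
    have hf : msg f = μ := (Finset.mem_filter.1 hf).2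
    exact mem_range_of_dnsProp hs f b ((h _ b).2 ⟨w f, by rw [← hf] at hb; exact hb⟩) k
  set u := (acceptedPoints (o μ)).card
  have hu : n * s ≤ 4 * u := by
    have h1 : msg f₀ = μ := (Finset.mem_filter.1 hf₀).2
    have h2 := hw f₀
    change n * s ≤ 4 * (acceptedPoints (o (msg f₀))).card at h2
    rwa [h1] at h2
  have hule : u ≤ n * s := by
    have h1 : acceptedPoints (o μ) ⊆ Finset.univ.map f₀ := fun v hv => by
      simpa using hsup f₀ hf₀ v hv
    simpa using Finset.card_le_card h1
  refine ⟨u, hu, ?_⟩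
  have hfib := card_embedding_range_superset_le _ _ hsup
  simp only [Fintype.card_prod, Fintype.card_fin] at hfib
  have hn : 0 < n := by omega
  have hfib' : (Finset.univ.filter fun f => msg f = μ).card * n ^ u ≤ (n ^ 3) ^ (n * s) := by
    calc _ ≤ ((n * s) ^ u * (n ^ 3) ^ (n * s - u)) * n ^ u := by gcongr
      _ ≤ ((n ^ 2) ^ u * (n ^ 3) ^ (n * s - u)) * n ^ u := by gcongr
      _ = (n ^ 3) ^ (u + (n * s - u)) := by ring
      _ = _ := by rw [Nat.add_sub_cancel' hule]
  refine le_of_mul_le_mul_left (a := (n ^ 3) ^ (n * s)) ?_ (by positivity)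
  calc (n ^ 3) ^ (n * s) * n ^ u
      ≤ (2 ^ (n * s) * (2 ^ cc * (Finset.univ.filter fun f => msg f = μ).card)) * n ^ u := by
        gcongr; exact hdesc.trans (by gcongr)
    _ = 2 ^ (n * s + cc) * ((Finset.univ.filter fun f => msg f = μ).card * n ^ u) := by ring
    _ ≤ 2 ^ (n * s + cc) * (n ^ 3) ^ (n * s) := by gcongr
    _ = _ := mul_comm _ _


/-- Every nondeterministic one-way protocol computing `D_{n,s}` with `⌊ε·s⌋`
nondeterministic bits has cost at least `c·n·s·log₂ n`. -/
theorem stmt10 :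
    ∃ ε : ℝ, 0 < ε ∧ ∃ c : ℝ, 0 < c ∧ ∃ s₀ n₀ : ℕ,
      ∀ n s : ℕ, n₀ ≤ n → s₀ ≤ s → s ≤ n →
        ∀ (cc : ℕ)
          (M : (Fin n → Fin s → Fin (n ^ 3)) → (Fin ⌊ε * s⌋₊ → Bool) → Fin (2 ^ cc))
          (o : Fin (2 ^ cc) → (Fin s → Fin (n ^ 3)) → Bool),
          (∀ a b, DnsProp n s a b ↔ ∃ w, o (M a w) b = true) →
          c * ((n : ℝ) * s * Real.logb 2 n) ≤ cc := by
  refine ⟨1, one_pos, 1 / 8, by norm_num, 2, 256, fun n s hn hs hsn cc => ?_⟩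
  rw [one_mul, Nat.floor_natCast]
  intro M o h
  obtain ⟨u, hu, hpow⟩ := exists_pow_le_two_pow hs hsn M o h
  have hn0 : (0 : ℝ) < n := by exact_mod_cast (by omega : 0 < n)
  have hlog : (8 : ℝ) ≤ Real.logb 2 n := by
    rw [Real.le_logb_iff_rpow_le one_lt_two hn0]
    norm_num
    exact hn
  have hpow' : (n : ℝ) ^ u ≤ 2 ^ (n * s + cc) := by exact_mod_cast hpow
  have h1 := Real.logb_le_logb_of_le one_lt_two (by positivity) hpow'
  rw [Real.logb_pow, Real.logb_pow, Real.logb_self_eq_one one_lt_two, mul_one] at h1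
  push_cast at h1
  have hu' : (n : ℝ) * s ≤ 4 * u := by exact_mod_cast hu
  have h2 := mul_le_mul_of_nonneg_right hu' (by linarith : (0 : ℝ) ≤ Real.logb 2 n)
  have h3 := mul_le_mul_of_nonneg_left hlog (by positivity : (0 : ℝ) ≤ (n : ℝ) * s)
  linarith
end

section
/- Let n ≥ 1 and 0 ≤ ε < 1/2. Consider the index function IX : {0,1}^n × {1,…,n} → {0,1} with IX(x,i) = x_i, where Alice receives x and Bob receives i. Every quantum one-way protocol of cost m computing IX with error ε satisfies m ≥ (1 − H(ε))·n. -/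
open scoped ComplexOrder

/-- `ρ` is a density matrix: positive semidefinite with trace 1. -/
def IsDensity {d : ℕ} (ρ : Matrix (Fin d) (Fin d) ℂ) : Prop :=
  ρ.PosSemidef ∧ ρ.trace = 1

/-- `E` is a POVM element: `E` and `I − E` are positive semidefinite. -/
def IsPOVMElem {d : ℕ} (E : Matrix (Fin d) (Fin d) ℂ) : Prop :=
  E.PosSemidef ∧ (1 - E).PosSemidef

/-- Acceptance probability `tr(E·ρ)` (a real number). -/
noncomputable def accProb {d : ℕ} (E ρ : Matrix (Fin d) (Fin d) ℂ) : ℝ :=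
  (E * ρ).trace.re

/-- The binary entropy function `H(ε) = −ε·log₂ ε − (1−ε)·log₂(1−ε)`
(with `H(0) = 0`, automatic since `Real.logb 2 0 = 0`). -/
noncomputable def binEnt (e : ℝ) : ℝ :=
  -(e * Real.logb 2 e) - (1 - e) * Real.logb 2 (1 - e)

/-- `(ρ, E)` is a quantum one-way protocol of cost `m` computing `g` with error
`ε`: Alice sends the `m`-qubit state `ρ a`, Bob measures with the POVM element
`E b`, accepting with probability `tr(E b · ρ a)`. -/
def QOneWay {A B : Type} (g : A → B → Bool) (m : ℕ) (ε : ℝ)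
    (ρ : A → Matrix (Fin (2 ^ m)) (Fin (2 ^ m)) ℂ)
    (E : B → Matrix (Fin (2 ^ m)) (Fin (2 ^ m)) ℂ) : Prop :=
  (∀ a, IsDensity (ρ a)) ∧ (∀ b, IsPOVMElem (E b)) ∧
  ∀ a b, if g a b then 1 - ε ≤ accProb (E b) (ρ a) else accProb (E b) (ρ a) ≤ ε

open Matrix Filter Topology
open scoped MatrixOrder Matrix.Norms.L2Operator

section PosSemidef

variable {ι : Type*} [Fintype ι] [DecidableEq ι]

lemma trace_mul_re_nonneg {P Q : Matrix ι ι ℂ} (hP : P.PosSemidef) (hQ : Q.PosSemidef) :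
    0 ≤ (P * Q).trace.re := by
  obtain ⟨A, rfl⟩ := CStarAlgebra.nonneg_iff_eq_star_mul_self.1 hQ.nonneg
  have h := (hP.mul_mul_conjTranspose_same A).trace_nonneg
  rw [← Matrix.mul_assoc, Matrix.trace_mul_comm, ← Matrix.mul_assoc]
  exact (Complex.nonneg_iff.1 h).1

lemma posSemidef_one_sub_of_trace_eq_one {P : Matrix ι ι ℂ} (hP : P.PosSemidef)
    (htr : P.trace = 1) : (1 - P).PosSemidef := by
  have hsum : ∑ i, hP.isHermitian.eigenvalues i = 1 := by
    have h := hP.isHermitian.trace_eq_sum_eigenvalues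
    rw [htr] at h
    exact Complex.ofReal_injective (by simpa using h.symm)
  have hle (i : ι) : hP.isHermitian.eigenvalues i ≤ 1 := by
    rw [← hsum]
    exact Finset.single_le_sum (fun j _ ↦ hP.eigenvalues_nonneg j) (Finset.mem_univ i)
  set U : Matrix ι ι ℂ := ↑hP.isHermitian.eigenvectorUnitary
  have hUU : U * Uᴴ = 1 := Matrix.mem_unitaryGroup_iff.1 hP.isHermitian.eigenvectorUnitary.2
  have hspec : P = U * diagonal (fun i ↦ (hP.isHermitian.eigenvalues i : ℂ)) * Uᴴ := by
    conv_lhs => rw [hP.isHermitian.spectral_theorem]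
    rfl
  have hdiag : (1 : Matrix ι ι ℂ) - diagonal (fun i ↦ (hP.isHermitian.eigenvalues i : ℂ)) =
      diagonal (fun i ↦ 1 - (hP.isHermitian.eigenvalues i : ℂ)) := by
    rw [← diagonal_one, diagonal_sub]
  have hps : (diagonal (fun i ↦ 1 - (hP.isHermitian.eigenvalues i : ℂ))).PosSemidef := by
    refine PosSemidef.diagonal fun i ↦ ?_
    have := hle i
    simp only [Pi.zero_apply, sub_nonneg]
    exact_mod_cast this
  have heq : 1 - P = U * diagonal (fun i ↦ 1 - (hP.isHermitian.eigenvalues i : ℂ)) * Uᴴ := by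
    rw [← hdiag, Matrix.mul_sub, Matrix.sub_mul, ← hspec, Matrix.mul_one, hUU]
  rw [heq]
  exact hps.mul_mul_conjTranspose_same U

lemma posSemidef_one_sub_conjTranspose_mul_mul {X Y : Matrix ι ι ℂ}
    (hX : (1 - Xᴴ * X).PosSemidef) (hY : (1 - Yᴴ * Y).PosSemidef) :
    (1 - (X * Y)ᴴ * (X * Y)).PosSemidef := by
  have h := hY.add (hX.conjTranspose_mul_mul_same Y)
  convert h using 1
  rw [conjTranspose_mul]
  noncomm_ring

lemma trace_re_le_card {X : Matrix ι ι ℂ} (hX : (1 - Xᴴ * X).PosSemidef) :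
    X.trace.re ≤ Fintype.card ι := by
  have h1 := (Complex.nonneg_iff.1 hX.trace_nonneg).1
  have h2 := (Complex.nonneg_iff.1 (posSemidef_conjTranspose_mul_self (1 - X)).trace_nonneg).1
  have h3 : (1 - X)ᴴ * (1 - X) = 1 - Xᴴ - X + Xᴴ * X := by
    rw [conjTranspose_sub, conjTranspose_one]
    noncomm_ring
  simp only [h3, trace_sub, trace_add, trace_one, trace_conjTranspose, Complex.sub_re,
    Complex.add_re, Complex.natCast_re, Complex.star_def, Complex.conj_re] at h1 h2
  linarith

lemma posSemidef_one_sub_of_isPOVMElem {d : ℕ} {E : Matrix (Fin d) (Fin d) ℂ}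
    (hE : IsPOVMElem E) :
    (1 - ((2 : ℂ) • E - 1)ᴴ * ((2 : ℂ) • E - 1)).PosSemidef := by
  obtain ⟨h0, h1⟩ := hE
  have hE' : Eᴴ = E := h0.isHermitian
  have hF' : (1 - E)ᴴ = 1 - E := h1.isHermitian
  have ha := h1.conjTranspose_mul_mul_same E
  have hb := h0.conjTranspose_mul_mul_same (1 - E)
  rw [hE'] at ha
  rw [hF'] at hb
  have h := (ha.add hb).smul (show (0 : ℂ) ≤ 4 by norm_num)
  convert h using 1
  rw [conjTranspose_sub, conjTranspose_smul, hE', conjTranspose_one]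
  have h2 : (2 : ℂ) • E = E + E := two_smul ℂ E
  have h4 (M : Matrix (Fin d) (Fin d) ℂ) : (4 : ℂ) • M = M + M + M + M := by
    rw [show (4 : ℂ) = 1 + 1 + 1 + 1 by norm_num]
    simp only [add_smul, one_smul]
  have hs : star (2 : ℂ) = 2 := by simp
  rw [hs, h2, h4]
  noncomm_ring

end PosSemidef

section Moments

variable {d : ℕ} {ρ M : Matrix (Fin d) (Fin d) ℂ}

lemma accProb_sq_le (hρ : IsDensity ρ) (hM : M.IsHermitian) :
    accProb M ρ ^ 2 ≤ accProb (M ^ 2) ρ := by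
  set μ := accProb M ρ with hμ
  have hN : (M - (μ : ℂ) • 1)ᴴ = M - (μ : ℂ) • (1 : Matrix (Fin d) (Fin d) ℂ) := by
    rw [conjTranspose_sub, conjTranspose_smul, conjTranspose_one, hM.eq]
    simp
  have h := trace_mul_re_nonneg
    (posSemidef_conjTranspose_mul_self (M - (μ : ℂ) • (1 : Matrix (Fin d) (Fin d) ℂ))) hρ.1
  have hexp : (M - (μ : ℂ) • 1)ᴴ * (M - (μ : ℂ) • (1 : Matrix (Fin d) (Fin d) ℂ)) * ρ
      = M ^ 2 * ρ - ((2 * μ : ℝ) : ℂ) • (M * ρ) + ((μ ^ 2 : ℝ) : ℂ) • ρ := by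
    rw [hN]
    simp only [sub_mul, mul_sub, smul_mul_assoc, mul_smul_comm, one_mul, mul_one, pow_two,
      Complex.ofReal_mul, Complex.ofReal_ofNat]
    module
  rw [hexp, trace_add, trace_sub, trace_smul, trace_smul, hρ.2, smul_eq_mul, smul_eq_mul,
    Complex.add_re, Complex.sub_re, Complex.re_ofReal_mul, Complex.re_ofReal_mul,
    Complex.one_re] at h
  change 0 ≤ accProb (M ^ 2) ρ - 2 * μ * accProb M ρ + μ ^ 2 * 1 at h
  rw [← hμ] at h
  linarith

lemma accProb_pow_two_pow_le (hρ : IsDensity ρ) (hM : M.IsHermitian) (j : ℕ) :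
    accProb M ρ ^ 2 ^ (j + 1) ≤ accProb (M ^ 2 ^ (j + 1)) ρ := by
  induction j with
  | zero => simpa using accProb_sq_le hρ hM
  | succ j ih =>
    have h0 : 0 ≤ accProb M ρ ^ 2 ^ (j + 1) :=
      Even.pow_nonneg (Even.pow_of_ne_zero even_two (Nat.succ_ne_zero j)) _
    rw [pow_succ 2 (j + 1), pow_mul, pow_mul]
    exact (pow_le_pow_left₀ h0 ih 2).trans (accProb_sq_le hρ (hM.pow _))

lemma pow_le_trace_pow_re (hρ : IsDensity ρ) (hM : M.IsHermitian) {c : ℝ} (hc : 0 ≤ c)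
    (hcM : c ≤ accProb M ρ) (j : ℕ) :
    c ^ 2 ^ (j + 1) ≤ (M ^ 2 ^ (j + 1)).trace.re := by
  have hpos : (M ^ 2 ^ (j + 1)).PosSemidef := by
    have h : M ^ 2 ^ (j + 1) = (M ^ 2 ^ j)ᴴ * M ^ 2 ^ j := by
      rw [(hM.pow (2 ^ j)).eq, ← pow_add, pow_succ 2 j, mul_two]
    rw [h]
    exact posSemidef_conjTranspose_mul_self _
  have h := trace_mul_re_nonneg hpos (posSemidef_one_sub_of_trace_eq_one hρ.1 hρ.2)
  rw [mul_sub, mul_one, trace_sub, Complex.sub_re, sub_nonneg] at h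
  exact (pow_le_pow_left₀ hc hcM _).trans ((accProb_pow_two_pow_le hρ hM j).trans h)

end Moments

section SignedSums

/-- The sign `±1` attached to a bit. -/
def bitSign (b : Bool) : ℝ := if b then 1 else -1

lemma sum_prod_bitSign_pow_nonneg {n : ℕ} (e : Fin n → ℕ) :
    0 ≤ ∑ x : Fin n → Bool, ∏ i, bitSign (x i) ^ e i := by
  have h := Finset.sum_prod_piFinset (Finset.univ : Finset Bool)
    (fun (i : Fin n) b ↦ bitSign b ^ e i)
  rw [Fintype.piFinset_univ] at h
  rw [h]
  refine Finset.prod_nonneg fun i _ ↦ ?_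
  rcases Nat.even_or_odd (e i) with h | h <;> simp [bitSign, h.neg_one_pow]

/-- Expanding the power gives words in the contractions `B i` whose coefficients, averaged over
the signs, are nonnegative, so the trace is largest when every `B i` is the identity. -/
lemma sum_trace_signed_pow_le {n d : ℕ} {B : Fin n → Matrix (Fin d) (Fin d) ℂ}
    (hB : ∀ i, (1 - (B i)ᴴ * B i).PosSemidef) {u : ℝ} (hu : 0 ≤ u) (k : ℕ) (e : Fin n → ℕ)
    {X : Matrix (Fin d) (Fin d) ℂ} (hX : (1 - Xᴴ * X).PosSemidef) :
    ∑ x : Fin n → Bool, (∏ i, bitSign (x i) ^ e i) *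
        (X * (1 + ∑ i, ((u * bitSign (x i) : ℝ) : ℂ) • B i) ^ k).trace.re ≤
      d * ∑ x : Fin n → Bool, (∏ i, bitSign (x i) ^ e i) *
        (1 + u * ∑ i, bitSign (x i)) ^ k := by
  induction k generalizing e X with
  | zero =>
    have h := trace_re_le_card hX
    simp only [Fintype.card_fin] at h
    simp only [pow_zero, mul_one, ← Finset.sum_mul]
    rw [mul_comm]
    exact mul_le_mul_of_nonneg_right h (sum_prod_bitSign_pow_nonneg e)
  | succ k ih =>
    have hsign (x : Fin n → Bool) (j : Fin n) :
        ∏ i, bitSign (x i) ^ (e + Pi.single j 1 : Fin n → ℕ) i =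
          bitSign (x j) * ∏ i, bitSign (x i) ^ e i := by
      simp only [Pi.add_apply, pow_add, Finset.prod_mul_distrib, Pi.single_apply, pow_ite,
        pow_zero, pow_one, Finset.prod_ite_eq', Finset.mem_univ, if_true]
      ring
    have hj (j : Fin n) := mul_le_mul_of_nonneg_left
      (ih (e + Pi.single j 1) (posSemidef_one_sub_conjTranspose_mul_mul hX (hB j))) hu
    have hsum := add_le_add (ih e hX) (Finset.sum_le_sum fun j (_ : j ∈ Finset.univ) ↦ hj j)
    simp only [hsign] at hsum
    refine le_of_eq_of_le ?_ (hsum.trans_eq ?_)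
    · simp only [Finset.mul_sum]
      rw [Finset.sum_comm, ← Finset.sum_add_distrib]
      refine Finset.sum_congr rfl fun x _ ↦ ?_
      rw [pow_succ', ← mul_assoc, mul_add, mul_one, add_mul, trace_add, Complex.add_re, mul_add,
        Finset.mul_sum, Finset.sum_mul, trace_sum, Complex.re_sum, Finset.mul_sum]
      congr 1
      refine Finset.sum_congr rfl fun j _ ↦ ?_
      rw [mul_smul_comm, smul_mul_assoc, trace_smul, smul_eq_mul, Complex.re_ofReal_mul]
      ring
    · simp only [Finset.mul_sum]
      rw [Finset.sum_comm, ← Finset.sum_add_distrib]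
      refine Finset.sum_congr rfl fun x _ ↦ ?_
      rw [pow_succ', add_mul, one_mul, mul_add, mul_add, ← Finset.mul_sum]
      congr 1
      simp only [Finset.mul_sum, Finset.sum_mul]
      refine Finset.sum_congr rfl fun j _ ↦ ?_
      ring

lemma sum_exp_bitSign (n : ℕ) (t : ℝ) :
    ∑ x : Fin n → Bool, Real.exp (t * ∑ i, bitSign (x i)) =
      (Real.exp t + Real.exp (-t)) ^ n := by
  have h := Finset.sum_prod_piFinset (Finset.univ : Finset Bool)
    (fun (_ : Fin n) b ↦ Real.exp (t * bitSign b))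
  rw [Fintype.piFinset_univ] at h
  simp only [Finset.mul_sum, Real.exp_sum]
  rw [h]
  simp [bitSign]

end SignedSums

section Protocol

variable {n m : ℕ} {ε : ℝ} {ρ : (Fin n → Bool) → Matrix (Fin (2 ^ m)) (Fin (2 ^ m)) ℂ}
  {E : Fin n → Matrix (Fin (2 ^ m)) (Fin (2 ^ m)) ℂ}

lemma le_accProb_signed
    (h : QOneWay (fun (x : Fin n → Bool) (i : Fin n) => x i) m ε ρ E)
    {u : ℝ} (hu : 0 ≤ u) (x : Fin n → Bool) :
    1 + u * ((1 - 2 * ε) * n) ≤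
      accProb (1 + ∑ i, ((u * bitSign (x i) : ℝ) : ℂ) • ((2 : ℂ) • E i - 1)) (ρ x) := by
  obtain ⟨hρ, -, hg⟩ := h
  have hi (i : Fin n) : 1 - 2 * ε ≤ bitSign (x i) * (2 * accProb (E i) (ρ x) - 1) := by
    have := hg x i
    cases hx : x i <;> simp [hx, bitSign] at this ⊢ <;> linarith
  have heq : accProb (1 + ∑ i, ((u * bitSign (x i) : ℝ) : ℂ) • ((2 : ℂ) • E i - 1)) (ρ x) =
      1 + ∑ i, u * (bitSign (x i) * (2 * accProb (E i) (ρ x) - 1)) := by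
    unfold accProb
    rw [add_mul, one_mul, trace_add, (hρ x).2, Complex.add_re, Complex.one_re, Finset.sum_mul,
      trace_sum, Complex.re_sum]
    congr 1
    refine Finset.sum_congr rfl fun i _ ↦ ?_
    rw [smul_mul_assoc, trace_smul, smul_eq_mul, Complex.re_ofReal_mul, sub_mul, one_mul,
      trace_sub, (hρ x).2, smul_mul_assoc, trace_smul, smul_eq_mul, Complex.sub_re,
      Complex.one_re, show (2 : ℂ) = ((2 : ℝ) : ℂ) by norm_num, Complex.re_ofReal_mul]
    ring
  rw [heq, ← Finset.mul_sum]
  have := Finset.sum_le_sum fun i (_ : i ∈ Finset.univ) ↦ hi i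
  simp only [Finset.sum_const, Finset.card_univ, Fintype.card_fin, nsmul_eq_mul] at this
  have := mul_le_mul_of_nonneg_left this hu
  linarith

lemma two_pow_mul_pow_le
    (h : QOneWay (fun (x : Fin n → Bool) (i : Fin n) => x i) m ε ρ E) (hε : ε ≤ 1 / 2)
    {u : ℝ} (hu : 0 ≤ u) (j : ℕ) :
    2 ^ n * (1 + u * ((1 - 2 * ε) * n)) ^ 2 ^ (j + 1) ≤
      2 ^ m * ∑ x : Fin n → Bool, (1 + u * ∑ i, bitSign (x i)) ^ 2 ^ (j + 1) := by
  have hherm (x : Fin n → Bool) :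
      (1 + ∑ i, ((u * bitSign (x i) : ℝ) : ℂ) • ((2 : ℂ) • E i - 1)).IsHermitian := by
    have hE (i : Fin n) : (E i)ᴴ = E i := (h.2.1 i).1.isHermitian
    simp [Matrix.IsHermitian, conjTranspose_sum, hE]
  have hc : 0 ≤ 1 + u * ((1 - 2 * ε) * n) := by
    have : 0 ≤ 1 - 2 * ε := by linarith
    positivity
  have hlow := Finset.sum_le_sum fun x (_ : x ∈ (Finset.univ : Finset (Fin n → Bool))) ↦
    pow_le_trace_pow_re (h.1 x) (hherm x) hc (le_accProb_signed h hu x) j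
  have hupp := sum_trace_signed_pow_le
    (fun i ↦ posSemidef_one_sub_of_isPOVMElem (h.2.1 i)) hu (2 ^ (j + 1)) 0
    (X := 1) (by simpa using PosSemidef.zero)
  simp only [Finset.sum_const, Finset.card_univ, Fintype.card_pi, Fintype.card_bool,
    Finset.prod_const, Fintype.card_fin, nsmul_eq_mul] at hlow
  simp only [Pi.zero_apply, pow_zero, Finset.prod_const_one, one_mul] at hupp
  exact_mod_cast hlow.trans hupp

lemma two_pow_mul_exp_le
    (h : QOneWay (fun (x : Fin n → Bool) (i : Fin n) => x i) m ε ρ E) (hε : ε ≤ 1 / 2)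
    {t : ℝ} (ht : 0 ≤ t) :
    2 ^ n * Real.exp (t * ((1 - 2 * ε) * n)) ≤
      2 ^ m * (Real.exp t + Real.exp (-t)) ^ n := by
  have hlim (y : ℝ) : Tendsto (fun j : ℕ ↦ (1 + t / (2 ^ (j + 1) : ℕ) * y) ^ 2 ^ (j + 1))
      atTop (𝓝 (Real.exp (t * y))) := by
    have hj : Tendsto (fun j : ℕ ↦ 2 ^ (j + 1)) atTop atTop :=
      (tendsto_pow_atTop_atTop_of_one_lt (r := 2) one_lt_two).comp (tendsto_add_atTop_nat 1)
    refine ((Real.tendsto_one_add_div_pow_exp (t * y)).comp hj).congr fun j ↦ ?_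
    simp only [Function.comp_apply, div_mul_eq_mul_div]
  rw [← sum_exp_bitSign]
  refine le_of_tendsto_of_tendsto' ((hlim _).const_mul _)
    ((tendsto_finsetSum _ fun x _ ↦ hlim _).const_mul _) fun j ↦ ?_
  exact two_pow_mul_pow_le h hε (by positivity) j

lemma log_le_of_qOneWay
    (h : QOneWay (fun (x : Fin n → Bool) (i : Fin n) => x i) m ε ρ E) (hε : ε ≤ 1 / 2)
    {t : ℝ} (ht : 0 ≤ t) :
    n * (Real.log 2 + t * (1 - 2 * ε) - Real.log (Real.exp t + Real.exp (-t))) ≤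
      m * Real.log 2 := by
  have h1 := Real.log_le_log (by positivity) (two_pow_mul_exp_le h hε ht)
  rw [Real.log_mul (by positivity) (by positivity), Real.log_mul (by positivity) (by positivity),
    Real.log_pow, Real.log_pow, Real.log_pow, Real.log_exp] at h1
  linarith

end Protocol

lemma binEnt_mul_log_two (ε : ℝ) :
    binEnt ε * Real.log 2 = -(ε * Real.log ε) - (1 - ε) * Real.log (1 - ε) := by
  have : Real.log 2 ≠ 0 := (Real.log_pos one_lt_two).ne'
  unfold binEnt Real.logb
  field_simp

lemma log_exp_half_log_div_add {ε : ℝ} (h0 : 0 < ε) (h1 : ε < 1) :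
    Real.log (Real.exp ((Real.log (1 - ε) - Real.log ε) / 2) +
        Real.exp (-((Real.log (1 - ε) - Real.log ε) / 2))) =
      -(Real.log ε + Real.log (1 - ε)) / 2 := by
  have h1' : 0 < 1 - ε := by linarith
  have hsum : Real.exp ((Real.log (1 - ε) - Real.log ε) / 2) +
      Real.exp (-((Real.log (1 - ε) - Real.log ε) / 2)) =
      Real.exp (-(Real.log ε + Real.log (1 - ε)) / 2) := by
    rw [show (Real.log (1 - ε) - Real.log ε) / 2 =
        Real.log (1 - ε) + -(Real.log ε + Real.log (1 - ε)) / 2 by ring,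
      show -(Real.log (1 - ε) + -(Real.log ε + Real.log (1 - ε)) / 2) =
        Real.log ε + -(Real.log ε + Real.log (1 - ε)) / 2 by ring,
      Real.exp_add, Real.exp_add, Real.exp_log h0, Real.exp_log h1']
    ring
  rw [hsum, Real.log_exp]

lemma tendsto_sub_log_exp_add_exp_neg :
    Tendsto (fun t : ℝ ↦ t - Real.log (Real.exp t + Real.exp (-t))) atTop (𝓝 0) := by
  have hexp : Tendsto (fun t : ℝ ↦ 1 + Real.exp (-(2 * t))) atTop (𝓝 1) := by
    simpa using (Real.tendsto_exp_neg_atTop_nhds_zero.comp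
      (tendsto_id.const_mul_atTop (two_pos (α := ℝ)))).const_add 1
  have hlog := (hexp.log one_ne_zero).neg
  rw [Real.log_one, neg_zero] at hlog
  refine hlog.congr fun t ↦ ?_
  have : Real.exp t + Real.exp (-t) = Real.exp t * (1 + Real.exp (-(2 * t))) := by
    rw [mul_add, mul_one, ← Real.exp_add]
    ring_nf
  rw [this, Real.log_mul (by positivity) (by positivity), Real.log_exp]
  ring

/-- Every quantum one-way protocol of cost `m` computing the index function
`IX(x,i) = x_i` with error `ε < 1/2` satisfies `m ≥ (1 − H(ε))·n`. -/
theorem stmt11 (n : ℕ) (hn : 1 ≤ n) (ε : ℝ) (hε0 : 0 ≤ ε) (hε1 : ε < 1/2)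
    (m : ℕ) (ρ : (Fin n → Bool) → Matrix (Fin (2 ^ m)) (Fin (2 ^ m)) ℂ)
    (E : Fin n → Matrix (Fin (2 ^ m)) (Fin (2 ^ m)) ℂ)
    (h : QOneWay (fun (x : Fin n → Bool) (i : Fin n) => x i) m ε ρ E) :
    (1 - binEnt ε) * n ≤ m := by
  have hlog2 : 0 < Real.log 2 := Real.log_pos one_lt_two
  refine le_of_mul_le_mul_right ?_ hlog2
  have hsplit : (1 - binEnt ε) * n * Real.log 2 =
      n * (Real.log 2 - binEnt ε * Real.log 2) := by ring
  rw [hsplit, binEnt_mul_log_two]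
  rcases hε0.eq_or_lt with rfl | hpos
  · have hlim := (tendsto_sub_log_exp_add_exp_neg.const_add (Real.log 2)).const_mul (n : ℝ)
    have hle := le_of_tendsto hlim (b := m * Real.log 2) <| by
      filter_upwards [eventually_ge_atTop 0] with t ht
      have := log_le_of_qOneWay h hε1.le ht
      simpa [add_sub_assoc] using this
    simpa using hle
  · have ht : 0 ≤ (Real.log (1 - ε) - Real.log ε) / 2 := by
      have := Real.log_le_log hpos (show ε ≤ 1 - ε by linarith)
      linarith
    have hle := log_le_of_qOneWay h hε1.le ht
    rw [log_exp_half_log_div_add hpos (by linarith)] at hle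
    refine le_of_eq_of_le ?_ hle
    ring
end

section
/- Let g : A × B → {0,1}, let 0 ≤ ε < 1/2, and let S ⊆ B be a finite set of cardinality d that is shattered by g. Then every quantum one-way protocol of cost m computing g with error ε satisfies m ≥ (1 − H(ε))·d. In particular, the bounded-error quantum one-way communication complexity of g is at least (1 − H(ε))·VC(g). -/
open scoped ComplexOrder

/-- The sign `±1` encoded by a Boolean. -/
def boolSign (b : Bool) : ℝ := if b then 1 else -1

lemma sum_prod_boolSign_pow_nonneg {ι : Type*} [Fintype ι] [DecidableEq ι] (k : ι → ℕ) :
    0 ≤ ∑ x : ι → Bool, ∏ i, boolSign (x i) ^ k i := by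
  have h := Finset.prod_univ_sum (fun _ : ι => (Finset.univ : Finset Bool))
    (fun i b => boolSign b ^ k i)
  rw [Fintype.piFinset_univ] at h
  rw [← h]
  refine Finset.prod_nonneg fun i _ => ?_
  rcases neg_one_pow_eq_or ℝ (k i) with hk | hk <;> simp [boolSign, hk]

lemma sum_exp_sum_boolSign {ι : Type*} [Fintype ι] [DecidableEq ι] (s : ℝ) :
    ∑ x : ι → Bool, Real.exp (∑ i, s * boolSign (x i)) =
      (Real.exp s + Real.exp (-s)) ^ Fintype.card ι := by
  have h := Finset.prod_univ_sum (fun _ : ι => (Finset.univ : Finset Bool))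
    (fun _ b => Real.exp (s * boolSign b))
  rw [Fintype.piFinset_univ] at h
  simp only [Real.exp_sum]
  rw [← h]
  simp [boolSign, Finset.prod_const]

lemma prod_boolSign_pow_add_single {ι : Type*} [Fintype ι] [DecidableEq ι] (k : ι → ℕ)
    (x : ι → Bool) (i : ι) :
    ∏ j, boolSign (x j) ^ (k + Pi.single i 1 : ι → ℕ) j =
      (∏ j, boolSign (x j) ^ k j) * boolSign (x i) := by
  simp only [Pi.add_apply, pow_add, Finset.prod_mul_distrib]
  congr 1
  rw [Finset.prod_eq_single i] <;> simp +contextual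

/-- Signed moments of a Rademacher sum of contractions are dominated by the corresponding
scalar moments. -/
lemma norm_sum_sign_smul_pow_le {ι R : Type*} [Fintype ι] [DecidableEq ι] [NormedRing R]
    [NormedAlgebra ℂ R] [NormOneClass R] (A : ι → R) (hA : ∀ i, ‖A i‖ ≤ 1) {c : ℝ} (hc : 0 ≤ c)
    (n : ℕ) (k : ι → ℕ) :
    ‖∑ x : ι → Bool, ((∏ i, boolSign (x i) ^ k i : ℝ) : ℂ) •
        (1 + ∑ i, ((c * boolSign (x i) : ℝ) : ℂ) • A i) ^ n‖ ≤
      ∑ x : ι → Bool, (∏ i, boolSign (x i) ^ k i) * (1 + ∑ i, c * boolSign (x i)) ^ n := by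
  induction n generalizing k with
  | zero =>
    simp only [pow_zero, mul_one, ← Finset.sum_smul, ← Complex.ofReal_sum]
    rw [norm_smul, norm_one, mul_one, Complex.norm_real, Real.norm_eq_abs,
      abs_of_nonneg (sum_prod_boolSign_pow_nonneg k)]
  | succ n ih =>
    set M : (ι → Bool) → R := fun x => 1 + ∑ i, ((c * boolSign (x i) : ℝ) : ℂ) • A i with hM
    set f : (ι → Bool) → ℝ := fun x => 1 + ∑ i, c * boolSign (x i) with hf
    set χ : (ι → ℕ) → (ι → Bool) → ℝ := fun k x => ∏ i, boolSign (x i) ^ k i with hχ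
    have hχs : ∀ x i, χ (k + Pi.single i 1) x = χ k x * boolSign (x i) := fun x i =>
      prod_boolSign_pow_add_single k x i
    have hR : ∑ x, (χ k x : ℂ) • M x ^ (n + 1) = ∑ x, (χ k x : ℂ) • M x ^ n +
        ∑ i, (c : ℂ) • ((∑ x, (χ (k + Pi.single i 1) x : ℂ) • M x ^ n) * A i) := by
      simp only [Finset.sum_mul, Finset.smul_sum]
      rw [Finset.sum_comm, ← Finset.sum_add_distrib]
      refine Finset.sum_congr rfl fun x _ => ?_
      conv_lhs => rw [pow_succ]; enter [2, 2]; rw [hM]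
      rw [mul_add, mul_one, smul_add, Finset.mul_sum, Finset.smul_sum]
      congr 1
      refine Finset.sum_congr rfl fun i _ => ?_
      rw [hχs, mul_smul_comm, smul_mul_assoc, smul_smul, smul_smul]
      push_cast
      congr 1
      ring
    have hr : ∑ x, χ k x * f x ^ (n + 1) = ∑ x, χ k x * f x ^ n +
        ∑ i, c * ∑ x, χ (k + Pi.single i 1) x * f x ^ n := by
      simp only [Finset.mul_sum]
      rw [Finset.sum_comm, ← Finset.sum_add_distrib]
      refine Finset.sum_congr rfl fun x _ => ?_
      conv_lhs => rw [pow_succ]; enter [2, 2]; rw [hf]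
      rw [mul_add, mul_one, mul_add, Finset.mul_sum, Finset.mul_sum]
      congr 1
      refine Finset.sum_congr rfl fun i _ => ?_
      rw [hχs]
      ring
    rw [hR, hr]
    refine (norm_add_le _ _).trans (add_le_add (ih k) ((norm_sum_le _ _).trans
      (Finset.sum_le_sum fun i _ => ?_)))
    rw [norm_smul, Complex.norm_real, Real.norm_eq_abs, abs_of_nonneg hc]
    refine mul_le_mul_of_nonneg_left ?_ hc
    refine (norm_mul_le _ _).trans ((mul_le_of_le_one_right (norm_nonneg _) (hA i)).trans
      (ih _))

open scoped Matrix.Norms.L2Operator in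
lemma Matrix.re_trace_le_card_mul_norm {n : Type*} [Fintype n] [DecidableEq n]
    (M : Matrix n n ℂ) : M.trace.re ≤ Fintype.card n * ‖M‖ := by
  rw [Matrix.trace, Complex.re_sum, ← nsmul_eq_mul, ← Finset.card_univ]
  refine Finset.sum_le_card_nsmul _ _ _ fun i _ => (Complex.re_le_norm _).trans ?_
  have h := M.l2_opNorm_mulVec (EuclideanSpace.single i 1)
  rw [PiLp.norm_single, norm_one, mul_one] at h
  refine le_trans ?_ h
  refine le_trans (le_of_eq ?_) (PiLp.norm_apply_le _ i)
  simp

open scoped Matrix.Norms.L2Operator MatrixOrder in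
lemma IsPOVMElem.norm_two_smul_sub_one_le {d : ℕ} {E : Matrix (Fin d) (Fin d) ℂ}
    (hE : IsPOVMElem E) : ‖(2 : ℂ) • E - 1‖ ≤ 1 := by
  obtain ⟨h0, h1⟩ := hE
  have hH : ((2 : ℂ) • E - 1).conjTranspose = (2 : ℂ) • E - 1 := by
    simp [Matrix.conjTranspose_sub, Matrix.conjTranspose_smul, h0.1.eq]
  have hsq : ‖((2 : ℂ) • E - 1).conjTranspose * ((2 : ℂ) • E - 1)‖ ≤ 1 := by
    rw [CStarAlgebra.norm_le_one_iff_of_nonneg _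
      (Matrix.nonneg_iff_posSemidef.2 (Matrix.posSemidef_conjTranspose_mul_self _)),
      Matrix.le_iff, hH]
    have h2 := (h1.mul_mul_conjTranspose_same E).add (h0.mul_mul_conjTranspose_same (1 - E))
    rw [h0.1.eq, h1.1.eq] at h2
    have h3 := h2.smul (show (0 : ℂ) ≤ 4 by norm_num)
    have hfour : 1 - ((2 : ℂ) • E - 1) * ((2 : ℂ) • E - 1) =
        (4 : ℂ) • ((E * (1 - E) * E) + (1 - E) * E * (1 - E)) := by
      rw [show (4 : ℂ) = ((4 : ℕ) : ℂ) by norm_num, show (2 : ℂ) = ((2 : ℕ) : ℂ) by norm_num,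
        Nat.cast_smul_eq_nsmul ℂ, Nat.cast_smul_eq_nsmul ℂ]
      noncomm_ring
    rwa [hfour]
  rw [Matrix.l2_opNorm_conjTranspose_mul_self] at hsq
  nlinarith [norm_nonneg ((2 : ℂ) • E - 1)]

/-- Jensen's inequality for the expectation of an even power of an observable. -/
lemma IsDensity.re_trace_mul_pow_le {d : ℕ} {ρ M : Matrix (Fin d) (Fin d) ℂ}
    (hρ : IsDensity ρ) (hM : M.IsHermitian) {n : ℕ} (hn : Even n) :
    (M * ρ).trace.re ^ n ≤ (M ^ n).trace.re := by
  let U : Matrix (Fin d) (Fin d) ℂ := (hM.eigenvectorUnitary : Matrix (Fin d) (Fin d) ℂ)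
  set l := hM.eigenvalues
  have hUU : star U * U = 1 := Unitary.coe_star_mul_self hM.eigenvectorUnitary
  have hUU' : U * star U = 1 := Unitary.coe_mul_star_self hM.eigenvectorUnitary
  set D : Matrix (Fin d) (Fin d) ℂ := Matrix.diagonal (fun i => (l i : ℂ)) with hD
  have hspec : M = U * D * star U := by
    conv_lhs => rw [hM.spectral_theorem, Unitary.conjStarAlgAut_apply]
    rfl
  have hpow : ∀ n : ℕ, M ^ n = U * D ^ n * star U := by
    intro n
    induction n with
    | zero => simp [hUU']
    | succ n ih =>
      rw [pow_succ, ih, hspec, pow_succ]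
      calc U * D ^ n * star U * (U * D * star U) = U * D ^ n * (star U * U) * D * star U := by
            noncomm_ring
        _ = _ := by rw [hUU]; noncomm_ring
  set τ := star U * ρ * U with hτ
  have hτ0 : τ.PosSemidef := by
    have := hρ.1.conjTranspose_mul_mul_same U
    exact this
  have hτ1 : τ.trace = 1 := by
    rw [hτ, Matrix.trace_mul_comm, ← mul_assoc, hUU', one_mul, hρ.2]
  have hdiag : ∀ i, 0 ≤ (τ i i).re := fun i => (Complex.le_def.1 (hτ0.diag_nonneg (i := i))).1
  have hsum : ∑ i, (τ i i).re = 1 := by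
    have := congrArg Complex.re hτ1
    simpa [Matrix.trace] using this
  have htr : (M * ρ).trace.re = ∑ i, (τ i i).re * l i := by
    have : (M * ρ).trace = (D * τ).trace := by
      rw [hspec, hτ, mul_assoc, mul_assoc, Matrix.trace_mul_comm]
      simp only [mul_assoc]
    rw [this, Matrix.trace, Complex.re_sum]
    refine Finset.sum_congr rfl fun i _ => ?_
    simp [hD, Matrix.diagonal_mul, mul_comm]
  have htrn : (M ^ n).trace.re = ∑ i, l i ^ n := by
    rw [hpow, Matrix.trace_mul_comm, ← mul_assoc, hUU, one_mul, hD, Matrix.diagonal_pow,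
      Matrix.trace_diagonal, Complex.re_sum]
    refine Finset.sum_congr rfl fun i _ => ?_
    simp [← Complex.ofReal_pow]
  rw [htr, htrn]
  refine (Real.pow_arith_mean_le_arith_mean_pow_of_even Finset.univ _ _ (fun i _ => hdiag i)
    hsum hn).trans (Finset.sum_le_sum fun i _ => ?_)
  refine mul_le_of_le_one_left (hn.pow_nonneg _) ?_
  rw [← hsum]
  exact Finset.single_le_sum (f := fun i => (τ i i).re) (fun i _ => hdiag i) (Finset.mem_univ i)

lemma accProb_two_smul_sub_one {d : ℕ} {ρ : Matrix (Fin d) (Fin d) ℂ} (hρ : IsDensity ρ)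
    (E : Matrix (Fin d) (Fin d) ℂ) : accProb ((2 : ℂ) • E - 1) ρ = 2 * accProb E ρ - 1 := by
  simp [accProb, sub_mul, Matrix.trace_sub, hρ.2]

open scoped Matrix.Norms.L2Operator in
/-- Moment form of the random access code bound. -/
lemma two_pow_mul_pow_le_of_accProb {ι : Type*} [Fintype ι] [DecidableEq ι] {D : ℕ} [NeZero D]
    (A : ι → Matrix (Fin D) (Fin D) ℂ) (hA : ∀ i, ‖A i‖ ≤ 1) (hAH : ∀ i, (A i).IsHermitian)
    (σ : (ι → Bool) → Matrix (Fin D) (Fin D) ℂ) (hσ : ∀ x, IsDensity (σ x)) {t : ℝ} (ht : 0 ≤ t)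
    (h : ∀ x i, t ≤ boolSign (x i) * accProb (A i) (σ x)) {c : ℝ} (hc : 0 ≤ c) {n : ℕ}
    (hn : Even n) :
    2 ^ Fintype.card ι * (1 + c * (Fintype.card ι * t)) ^ n ≤
      D * ∑ x : ι → Bool, (1 + ∑ i, c * boolSign (x i)) ^ n := by
  set M : (ι → Bool) → Matrix (Fin D) (Fin D) ℂ :=
    fun x => 1 + ∑ i, ((c * boolSign (x i) : ℝ) : ℂ) • A i with hM
  have hMH : ∀ x, (M x).IsHermitian := fun x => by
    simp only [Matrix.IsHermitian, hM, Matrix.conjTranspose_add, Matrix.conjTranspose_one,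
      Matrix.conjTranspose_sum, Matrix.conjTranspose_smul, (hAH _).eq, RCLike.star_def,
      Complex.conj_ofReal]
  have hlow : ∀ x, 1 + c * (Fintype.card ι * t) ≤ (M x * σ x).trace.re := fun x => by
    have hMσ : (M x * σ x).trace.re = 1 + ∑ i, c * (boolSign (x i) * accProb (A i) (σ x)) := by
      simp only [hM, add_mul, one_mul, Finset.sum_mul, smul_mul_assoc, Matrix.trace_add,
        Matrix.trace_sum, Matrix.trace_smul, (hσ x).2, Complex.add_re, Complex.one_re,
        Complex.re_sum, smul_eq_mul, Complex.re_ofReal_mul, accProb, mul_assoc]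
    rw [hMσ, ← Finset.mul_sum]
    gcongr
    rw [← nsmul_eq_mul, ← Finset.card_univ]
    exact Finset.card_nsmul_le_sum _ _ _ fun i _ => h x i
  have hmom := norm_sum_sign_smul_pow_le A hA hc n 0
  simp only [Pi.zero_apply, pow_zero, Finset.prod_const_one, Complex.ofReal_one, one_smul,
    one_mul] at hmom
  calc 2 ^ Fintype.card ι * (1 + c * (Fintype.card ι * t)) ^ n
      = ∑ _x : ι → Bool, (1 + c * (Fintype.card ι * t)) ^ n := by simp
    _ ≤ ∑ x : ι → Bool, ((M x) ^ n).trace.re := Finset.sum_le_sum fun x _ =>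
        (pow_le_pow_left₀ (by positivity) (hlow x) n).trans
          ((hσ x).re_trace_mul_pow_le (hMH x) hn)
    _ = (∑ x : ι → Bool, (M x) ^ n).trace.re := by rw [Matrix.trace_sum, Complex.re_sum]
    _ ≤ D * ‖∑ x : ι → Bool, (M x) ^ n‖ := by
        simpa using Matrix.re_trace_le_card_mul_norm (∑ x : ι → Bool, (M x) ^ n)
    _ ≤ _ := by gcongr

open scoped Matrix.Norms.L2Operator in
/-- Exponential form of the random access code bound. -/
lemma two_pow_mul_exp_le_of_accProb {ι : Type*} [Fintype ι] [DecidableEq ι] {D : ℕ} [NeZero D]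
    (A : ι → Matrix (Fin D) (Fin D) ℂ) (hA : ∀ i, ‖A i‖ ≤ 1) (hAH : ∀ i, (A i).IsHermitian)
    (σ : (ι → Bool) → Matrix (Fin D) (Fin D) ℂ) (hσ : ∀ x, IsDensity (σ x)) {t : ℝ} (ht : 0 ≤ t)
    (h : ∀ x i, t ≤ boolSign (x i) * accProb (A i) (σ x)) {s : ℝ} (hs : 0 ≤ s) :
    2 ^ Fintype.card ι * Real.exp (s * (Fintype.card ι * t)) ≤
      D * (Real.exp s + Real.exp (-s)) ^ Fintype.card ι := by
  have heven : Filter.Tendsto (fun k : ℕ => 2 * k) Filter.atTop Filter.atTop :=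
    Filter.tendsto_id.const_mul_atTop' two_pos
  rw [← sum_exp_sum_boolSign]
  refine le_of_tendsto_of_tendsto'
    (((Real.tendsto_one_add_div_pow_exp (s * (Fintype.card ι * t))).comp heven).const_mul _)
    ((tendsto_finsetSum Finset.univ fun (x : ι → Bool) _ =>
      (Real.tendsto_one_add_div_pow_exp (∑ i, s * boolSign (x i))).comp heven).const_mul _)
    fun k => ?_
  have hk := two_pow_mul_pow_le_of_accProb A hA hAH σ hσ ht h
    (c := s / ((2 * k : ℕ) : ℝ)) (by positivity) (even_two_mul k)
  simpa only [Function.comp_apply, Finset.sum_div, div_mul_eq_mul_div] using hk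

lemma binEnt_eq_binEntropy_div_log_two (e : ℝ) : binEnt e = Real.binEntropy e / Real.log 2 := by
  rw [binEnt, Real.binEntropy, Real.logb, Real.logb, Real.log_inv, Real.log_inv]
  ring

lemma QOneWay.mono {A B : Type} {g : A → B → Bool} {m : ℕ} {ε ε' : ℝ}
    {ρ : A → Matrix (Fin (2 ^ m)) (Fin (2 ^ m)) ℂ} {E : B → Matrix (Fin (2 ^ m)) (Fin (2 ^ m)) ℂ}
    (h : QOneWay g m ε ρ E) (hε : ε ≤ ε') : QOneWay g m ε' ρ E := by
  refine ⟨h.1, h.2.1, fun a b => ?_⟩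
  have hab := h.2.2 a b
  split_ifs at hab ⊢ <;> linarith

lemma QOneWay.le_cost_of_pos {A B : Type} {g : A → B → Bool} {ε : ℝ} (hε0 : 0 < ε)
    (hε1 : ε < 1 / 2) {S : Finset B} (hS : Shatters g S) {m : ℕ}
    {ρ : A → Matrix (Fin (2 ^ m)) (Fin (2 ^ m)) ℂ} {E : B → Matrix (Fin (2 ^ m)) (Fin (2 ^ m)) ℂ}
    (h : QOneWay g m ε ρ E) : (1 - binEnt ε) * S.card ≤ m := by
  classical
  obtain ⟨hρ, hE, hacc⟩ := h
  have hrow : ∀ x : S → Bool, ∃ a, ∀ b : S, g a b = x b := fun x => by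
    obtain ⟨a, ha⟩ := hS ((Finset.univ.filter fun b => x b = true).map
      (Function.Embedding.subtype _)) (fun b hb => by
        obtain ⟨b', -, rfl⟩ := Finset.mem_map.1 hb
        exact b'.2)
    refine ⟨a, fun b => ?_⟩
    rw [Bool.eq_iff_iff, ha b b.2]
    simp
  choose a ha using hrow
  have hsign : ∀ (x : S → Bool) (b : S),
      1 - 2 * ε ≤ boolSign (x b) * accProb ((2 : ℂ) • E b - 1) (ρ (a x)) := fun x b => by
    rw [accProb_two_smul_sub_one (hρ _)]
    have hab := hacc (a x) b
    rw [ha] at hab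
    cases hx : x b <;> simp only [hx, boolSign, if_true, Bool.false_eq_true, if_false] at hab ⊢ <;>
      linarith
  set s : ℝ := (Real.log (1 - ε) - Real.log ε) / 2 with hs_def
  have hs : 0 ≤ s := by
    have := Real.log_le_log hε0 (show ε ≤ 1 - ε by linarith)
    rw [hs_def]; linarith
  have key := two_pow_mul_exp_le_of_accProb (fun b : S => (2 : ℂ) • E b - 1)
    (fun b => (hE b).norm_two_smul_sub_one_le)
    (fun b => by
      simp [Matrix.IsHermitian, Matrix.conjTranspose_sub, Matrix.conjTranspose_smul,
        (hE b).1.1.eq])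
    (fun x => ρ (a x)) (fun x => hρ _) (by linarith) hsign hs
  rw [Fintype.card_coe] at key
  have hcosh : Real.exp s + Real.exp (-s) = Real.exp (-s - Real.log ε) := by
    have h1 : Real.exp s = (1 - ε) * Real.exp (-s - Real.log ε) := by
      rw [← Real.exp_log (show 0 < 1 - ε by linarith)]
      rw [← Real.exp_add]
      congr 1
      rw [hs_def]; ring
    have h2 : Real.exp (-s) = ε * Real.exp (-s - Real.log ε) := by
      conv_rhs => rw [Real.exp_sub, Real.exp_log hε0]
      field_simp
    rw [h1, h2]; ring
  rw [hcosh] at key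
  have hlog := Real.log_le_log (by positivity) key
  rw [Real.log_mul (by positivity) (by positivity), Real.log_mul (by positivity) (by positivity),
    Real.log_exp, Real.log_pow, Real.log_pow, Real.log_exp, Nat.cast_pow, Real.log_pow] at hlog
  have hl2 : 0 < Real.log 2 := Real.log_pos one_lt_two
  rw [binEnt_eq_binEntropy_div_log_two, one_sub_div hl2.ne', div_mul_eq_mul_div, div_le_iff₀ hl2,
    Real.binEntropy, Real.log_inv, Real.log_inv]
  have hs2 : 2 * s = Real.log (1 - ε) - Real.log ε := by rw [hs_def]; ring
  push_cast at hlog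
  have hid : Real.log 2 - (ε * -Real.log ε + (1 - ε) * -Real.log (1 - ε)) =
      Real.log 2 + s * (1 - 2 * ε) - (-s - Real.log ε) := by
    linear_combination -(1 - ε) * hs2
  rw [hid]
  linarith

/-- If `g` shatters a set of size `d`, every quantum one-way protocol of cost `m`
computing `g` with error `ε < 1/2` satisfies `m ≥ (1 − H(ε))·d`; in particular the
bounded-error quantum one-way communication complexity of `g` is at least
`(1 − H(ε))·VC(g)`. -/
theorem stmt12 {A B : Type} (g : A → B → Bool) (ε : ℝ) (hε0 : 0 ≤ ε)
    (hε1 : ε < 1/2) (S : Finset B) (hS : Shatters g S) (d : ℕ) (hd : S.card = d)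
    (m : ℕ) (ρ : A → Matrix (Fin (2 ^ m)) (Fin (2 ^ m)) ℂ)
    (E : B → Matrix (Fin (2 ^ m)) (Fin (2 ^ m)) ℂ)
    (h : QOneWay g m ε ρ E) :
    (1 - binEnt ε) * d ≤ m := by
  subst hd
  have hcont : Continuous fun e => (1 - binEnt e) * (S.card : ℝ) := by
    simp only [binEnt_eq_binEntropy_div_log_two]
    fun_prop
  refine le_of_tendsto (hcont.continuousWithinAt (s := Set.Ioi ε) (x := ε)).tendsto ?_
  filter_upwards [Ioo_mem_nhdsGT hε1] with e he
  exact (h.mono he.1.le).le_cost_of_pos (hε0.trans_lt he.1) he.2 hS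
end
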